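/- arXiv:0911.3913 — 3 statements merged into one kernel-verified Lean document; each statement's English description precedes it below -/
import Mathlib

section
/- Let d ∈ {1,2,3} and let ν₀ be the Hastings–McLeod solution of the Painlevé-II equation. Then there exist ε₀ > 0 and C > 0 such that for every 0 < ε < ε₀ there exists a strictly positive classical solution η_ε of ε²Δη_ε + (1−|x|²)η_ε − η_ε³ = 0 on ℝ^d satisfying sup_{x ∈ ℝ^d} | η_ε(x) − ε^{1/3} ν₀((1−|x|²)/ε^{2/3}) | ≤ C ε^{(4−d)/3}. -/
open Filter Real MeasureTheory

/-- The Laplacian of `u : ℝ^d → ℝ`, as the sum of second partial derivatives. -/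
noncomputable def lap {d : ℕ} (u : EuclideanSpace ℝ (Fin d) → ℝ)
    (x : EuclideanSpace ℝ (Fin d)) : ℝ :=
  ∑ i : Fin d,
    fderiv ℝ (fun y => fderiv ℝ u y (EuclideanSpace.single i 1)) x (EuclideanSpace.single i 1)

open Set Topology

/-- A function with positive second derivative at a critical point has no local maximum there. -/
lemma not_isLocalMax_of_hasDerivAt_pos {f f₁ : ℝ → ℝ} {x c : ℝ}
    (h₁ : ∀ᶠ y in 𝓝 x, HasDerivAt f (f₁ y) y) (h₂ : HasDerivAt f₁ c x) (hc : 0 < c) :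
    ¬ IsLocalMax f x := by
  intro hmax
  have e₁ : deriv f =ᶠ[𝓝 x] f₁ := h₁.mono fun y hy => hy.deriv
  have e₂ : deriv (deriv f) x = c := by rw [e₁.deriv_eq, h₂.deriv]
  have e₃ : deriv f x = 0 := hmax.deriv_eq_zero
  have hmin := isLocalMin_of_deriv_deriv_pos (by rw [e₂]; exact hc) e₃
    h₁.self_of_nhds.continuousAt
  have e₄ : f =ᶠ[𝓝 x] fun _ => f x := by
    filter_upwards [hmin, hmax] with y hy hy'
    exact le_antisymm hy' hy
  have e₅ := e₄.deriv.deriv_eq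
  rw [e₂] at e₅
  simp at e₅
  exact hc.ne' e₅

/-- A sublinear function, nonpositive at `Y` and strictly convex where it is positive, is
nonpositive on `[Y, ∞)`. -/
lemma nonpos_of_sublinear_of_convex_where_pos {m m₁ m₂ : ℝ → ℝ} {Y : ℝ}
    (h₁ : ∀ y ≥ Y, HasDerivAt m (m₁ y) y) (h₂ : ∀ y ≥ Y, HasDerivAt m₁ (m₂ y) y)
    (hconv : ∀ y ≥ Y, 0 < m y → 0 < m₂ y) (hY : m Y ≤ 0)
    (hlim : Tendsto (fun y => m y / y) atTop (𝓝 0)) : ∀ y ≥ Y, m y ≤ 0 := by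
  have key : ∀ τ > 0, ∀ y ≥ Y, m y - τ * (y - Y) ≤ 0 := by
    intro τ hτ y hy
    by_contra! hcon
    have ev : ∀ᶠ t in atTop, m t - τ * (t - Y) ≤ 0 := by
      have e₁ : ∀ᶠ t in atTop, m t / t < τ / 2 := hlim.eventually_lt_const (by positivity)
      filter_upwards [e₁, eventually_gt_atTop 0, eventually_ge_atTop (2 * Y)] with t a₁ a₂ a₃
      rw [div_lt_iff₀ a₂] at a₁
      nlinarith
    obtain ⟨b, hb, hby⟩ := (ev.and (eventually_gt_atTop y)).exists
    have hcont : ContinuousOn (fun t => m t - τ * (t - Y)) (Icc Y b) := by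
      refine ContinuousOn.sub (fun t ht => (h₁ t ht.1).continuousAt.continuousWithinAt) ?_
      fun_prop
    obtain ⟨ξ, hξ, hmax⟩ := isCompact_Icc.exists_isMaxOn ⟨Y, by simp; linarith⟩ hcont
    have hpos : 0 < m ξ - τ * (ξ - Y) := lt_of_lt_of_le hcon (hmax (⟨hy, hby.le⟩ : y ∈ Icc Y b))
    have hξY : Y < ξ := by
      rcases hξ.1.eq_or_lt with h | h
      · rw [← h] at hpos; linarith
      · exact h
    have hξb : ξ < b := by
      rcases hξ.2.eq_or_lt with h | h
      · rw [h] at hpos; linarith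
      · exact h
    refine not_isLocalMax_of_hasDerivAt_pos (f := fun t => m t - τ * (t - Y))
      (f₁ := fun t => m₁ t - τ) (c := m₂ ξ) ?_ ?_ ?_ (hmax.isLocalMax (Icc_mem_nhds hξY hξb))
    · filter_upwards [lt_mem_nhds hξY] with t ht
      exact ((h₁ t ht.le).sub (((hasDerivAt_id t).sub_const Y).const_mul τ)).congr_deriv (by simp)
    · exact (h₂ ξ hξY.le).sub_const τ
    · refine hconv ξ hξY.le ?_
      nlinarith
  intro y hy
  by_contra! hcon
  rcases hy.eq_or_lt with h | h
  · rw [← h] at hcon; linarith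
  · have := key (m y / (2 * (y - Y))) (by have : 0 < y - Y := by linarith
                                          positivity) y hy
    have h' : y - Y ≠ 0 := by linarith
    have e : m y / (2 * (y - Y)) * (y - Y) = m y / 2 := by field_simp
    rw [e] at this
    linarith

/-- The hypotheses on the Hastings–McLeod solution `ν` with derivative `ν₁` that are used. -/
structure IsHastingsMcLeod (ν ν₁ : ℝ → ℝ) : Prop where
  pos : ∀ y, 0 < ν y
  mono : StrictMono ν
  deriv₁ : ∀ y, HasDerivAt ν (ν₁ y) y
  deriv₂ : ∀ y, HasDerivAt ν₁ ((ν y ^ 3 - y * ν y) / 4) y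
  top : Tendsto (fun y => ν y / √y) atTop (𝓝 1)

namespace IsHastingsMcLeod

variable {ν ν₁ : ℝ → ℝ}

lemma deriv_nonneg (h : IsHastingsMcLeod ν ν₁) (y : ℝ) : 0 ≤ ν₁ y := by
  rw [← (h.deriv₁ y).deriv]
  exact h.mono.monotone.deriv_nonneg

lemma continuous (h : IsHastingsMcLeod ν ν₁) : Continuous ν :=
  continuous_iff_continuousAt.2 fun y => (h.deriv₁ y).continuousAt

lemma continuous_deriv (h : IsHastingsMcLeod ν ν₁) : Continuous ν₁ :=
  continuous_iff_continuousAt.2 fun y => (h.deriv₂ y).continuousAt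

lemma slope (h : IsHastingsMcLeod ν ν₁) {a b : ℝ} (hab : a < b) :
    ∃ c ∈ Ioo a b, ν b - ν a = ν₁ c * (b - a) := by
  obtain ⟨c, hc, e⟩ := exists_hasDerivAt_eq_slope ν ν₁ hab h.continuous.continuousOn
    fun x _ => h.deriv₁ x
  refine ⟨c, hc, ?_⟩
  rw [e, div_mul_cancel₀]
  linarith

lemma slope_deriv (h : IsHastingsMcLeod ν ν₁) {a b : ℝ} (hab : a < b) :
    ∃ c ∈ Ioo a b, ν₁ b - ν₁ a = (ν c ^ 3 - c * ν c) / 4 * (b - a) := by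
  obtain ⟨c, hc, e⟩ := exists_hasDerivAt_eq_slope ν₁ _ hab h.continuous_deriv.continuousOn
    fun x _ => h.deriv₂ x
  refine ⟨c, hc, ?_⟩
  rw [e, div_mul_cancel₀]
  linarith

lemma deriv_mono_of_nonpos (h : IsHastingsMcLeod ν ν₁) {a b : ℝ} (hab : a < b) (hb : b ≤ 0) :
    ν₁ a ≤ ν₁ b := by
  obtain ⟨c, hc, e⟩ := h.slope_deriv hab
  have h₁ := h.pos c
  have h₂ : 0 ≤ (ν c ^ 3 - c * ν c) / 4 * (b - a) := by
    have : 0 ≤ -c * ν c := mul_nonneg (by linarith [hc.2]) h₁.le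
    have : 0 < ν c ^ 3 := by positivity
    exact mul_nonneg (by linarith) (by linarith)
  linarith

lemma deriv_le_mul (h : IsHastingsMcLeod ν ν₁) :
    ∃ C > 0, ∀ z ≤ 0, ν₁ z ≤ C * (1 - z) * ν z := by
  refine ⟨ν 0 ^ 2 + 3, by positivity, fun z hz => ?_⟩
  obtain ⟨c, hc, e⟩ := h.slope (show z - 1 < z by linarith)
  obtain ⟨x, hx, e'⟩ := h.slope_deriv hc.2
  have p₁ := h.pos (z - 1)
  have p₂ := h.pos z
  have p₃ := h.pos x
  have hxz : ν x ≤ ν z := h.mono.monotone hx.2.le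
  have hx0 : ν x ≤ ν 0 := h.mono.monotone (by linarith [hx.2])
  have hcz : z - c ≤ 1 := by linarith [hc.1]
  have hcz' : 0 < z - c := by linarith [hc.2]
  have hxl : z - 1 < x := by linarith [hx.1, hc.1]
  have b₁ : ν x ^ 3 - x * ν x = (ν x ^ 2 - x) * ν x := by ring
  have b₂ : (ν x ^ 2 - x) * ν x ≤ (ν 0 ^ 2 + 1 - z) * ν z := by
    apply mul_le_mul _ hxz p₃.le (by nlinarith)
    have : ν x ^ 2 ≤ ν 0 ^ 2 := by gcongr
    linarith
  have b₃ : 0 ≤ (ν x ^ 2 - x) * ν x := by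
    apply mul_nonneg _ p₃.le
    nlinarith [hx.2, sq_nonneg (ν x)]
  have b₄ : ν₁ z - ν₁ c ≤ (ν 0 ^ 2 + 1 - z) * ν z := by
    rw [e', b₁]
    nlinarith
  have b₅ : ν₁ c ≤ ν z := by nlinarith
  have b₆ : 0 ≤ ν 0 ^ 2 * (-z) * ν z := by
    apply mul_nonneg (mul_nonneg (sq_nonneg _) (by linarith)) p₂.le
  have b₇ : 0 ≤ (-z) * ν z := mul_nonneg (by linarith) p₂.le
  nlinarith

lemma tendsto_sq_div (h : IsHastingsMcLeod ν ν₁) :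
    Tendsto (fun y => ν y ^ 2 / y) atTop (𝓝 1) := by
  have := h.top.pow 2
  rw [one_pow] at this
  refine this.congr' ?_
  filter_upwards [eventually_ge_atTop 0] with y hy
  rw [div_pow, Real.sq_sqrt hy]

lemma tendsto_sq_sub_div (h : IsHastingsMcLeod ν ν₁) :
    Tendsto (fun y => (ν y ^ 2 - y) / y) atTop (𝓝 0) := by
  have := h.tendsto_sq_div.sub_const 1
  rw [sub_self] at this
  refine this.congr' ?_
  filter_upwards [eventually_gt_atTop 0] with y hy
  field_simp

lemma exists_sq_le (h : IsHastingsMcLeod ν ν₁) (Y₀ : ℝ) : ∃ Y ≥ Y₀, ν Y ^ 2 ≤ Y := by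
  by_contra! hcon
  obtain ⟨c, hc, e⟩ := h.slope (show Y₀ < Y₀ + 1 by linarith)
  have hc₁ : 0 < ν₁ c := by
    have := h.mono (show Y₀ < Y₀ + 1 by linarith)
    nlinarith
  have inc : ∀ y > c, ν₁ c ≤ ν₁ y := by
    intro y hy
    obtain ⟨x, hx, e'⟩ := h.slope_deriv hy
    have q := hcon x (by linarith [hx.1, hc.1])
    have : 0 ≤ (ν x ^ 3 - x * ν x) / 4 * (y - c) := by
      have e₁ : ν x ^ 3 - x * ν x = (ν x ^ 2 - x) * ν x := by ring
      rw [e₁]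
      have : 0 ≤ (ν x ^ 2 - x) * ν x := mul_nonneg (by linarith) (h.pos x).le
      exact mul_nonneg (by linarith) (by linarith)
    linarith
  have lin : ∀ y > c, ν₁ c * (y - c) ≤ ν y := by
    intro y hy
    obtain ⟨x, hx, e'⟩ := h.slope hy
    have := inc x hx.1
    have := h.pos c
    nlinarith
  have e₁ : ∀ᶠ y in atTop, ν y ^ 2 / y < 2 := h.tendsto_sq_div.eventually_lt_const (by norm_num)
  obtain ⟨y, h₁, h₂, h₃, h₄⟩ := (e₁.and ((eventually_gt_atTop 0).and
    ((eventually_gt_atTop (2 * c)).and (eventually_gt_atTop (8 / ν₁ c ^ 2))))).exists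
  rw [div_lt_iff₀ h₂] at h₁
  rw [div_lt_iff₀ (by positivity)] at h₄
  have hyc : c < y := by linarith
  have l := lin y hyc
  have l₂ : ν₁ c * (y / 2) ≤ ν y := by nlinarith
  have l₃ : (ν₁ c * (y / 2)) ^ 2 ≤ ν y ^ 2 := by gcongr
  nlinarith

lemma eventually_sq_le (h : IsHastingsMcLeod ν ν₁) : ∃ Y ≥ 4, ∀ z ≥ Y, ν z ^ 2 ≤ z ∧ z ≤ 2 * ν z ^ 2 := by
  have e₁ : ∀ᶠ y in atTop, 1 / 2 < ν y ^ 2 / y := h.tendsto_sq_div.eventually_const_lt (by norm_num)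
  obtain ⟨Y₀, hY₀⟩ := eventually_atTop.1 e₁
  obtain ⟨Y, hY, hY'⟩ := h.exists_sq_le (max Y₀ 4)
  have hY4 : 4 ≤ Y := le_trans (le_max_right _ _) hY
  refine ⟨Y, hY4, fun z hz => ⟨?_, ?_⟩⟩
  · have := nonpos_of_sublinear_of_convex_where_pos (Y := Y) (m := fun y => ν y ^ 2 - y)
      (m₁ := fun y => 2 * ν y * ν₁ y - 1)
      (m₂ := fun y => 2 * ν₁ y ^ 2 + ν y ^ 2 * (ν y ^ 2 - y) / 2) ?_ ?_ ?_ (by linarith)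
      h.tendsto_sq_sub_div z hz
    · linarith
    · intro y _
      exact (((h.deriv₁ y).pow 2).sub (hasDerivAt_id y)).congr_deriv (by simp)
    · intro y _
      exact ((((h.deriv₁ y).const_mul 2).mul (h.deriv₂ y)).sub_const 1).congr_deriv (by ring)
    · intro y _ hp
      have := h.pos y
      positivity
  · have := hY₀ z (le_trans (le_max_left _ _) (le_trans hY hz))
    rw [lt_div_iff₀ (by linarith)] at this
    linarith

lemma deriv_anti (h : IsHastingsMcLeod ν ν₁) {Y : ℝ} (hY : ∀ z ≥ Y, ν z ^ 2 ≤ z) {a b : ℝ}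
    (ha : Y ≤ a) (hab : a < b) : ν₁ b ≤ ν₁ a := by
  obtain ⟨c, hc, e⟩ := h.slope_deriv hab
  have q := hY c (by linarith [hc.1])
  have : 0 ≤ -((ν c ^ 3 - c * ν c) / 4 * (b - a)) := by
    have e₁ : -((ν c ^ 3 - c * ν c) / 4 * (b - a)) = (c - ν c ^ 2) * ν c / 4 * (b - a) := by ring
    rw [e₁]
    have : 0 ≤ (c - ν c ^ 2) * ν c := mul_nonneg (by linarith) (h.pos c).le
    exact mul_nonneg (by linarith) (by linarith)
  linarith

lemma deriv_bdd (h : IsHastingsMcLeod ν ν₁) : ∃ B > 0, ∀ y, ν₁ y ≤ B := by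
  obtain ⟨Y, hY4, hY⟩ := h.eventually_sq_le
  obtain ⟨B, hB⟩ := (isCompact_Icc (a := 0) (b := Y)).bddAbove_image h.continuous_deriv.continuousOn
  have hB' : ∀ y ∈ Icc 0 Y, ν₁ y ≤ B := fun y hy => hB (mem_image_of_mem _ hy)
  refine ⟨max B 1, by positivity, fun y => le_trans ?_ (le_max_left _ _)⟩
  rcases lt_or_ge y 0 with h₀ | h₀
  · exact (h.deriv_mono_of_nonpos h₀ le_rfl).trans (hB' 0 ⟨le_rfl, by linarith⟩)
  rcases le_or_gt y Y with h₁ | h₁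
  · exact hB' y ⟨h₀, h₁⟩
  · exact (h.deriv_anti (fun z hz => (hY z hz).1) le_rfl h₁).trans (hB' Y ⟨by linarith, le_rfl⟩)

lemma deriv₂_bdd_nonpos (h : IsHastingsMcLeod ν ν₁) :
    ∃ B, ∀ y ≤ -2, ν y ^ 3 - y * ν y ≤ B := by
  refine ⟨ν 0 ^ 3 + 4 * ν 1 + ν 0, fun y hy => ?_⟩
  have key : (-(y + 1)) * ν y ≤ 4 * ν 1 := by
    obtain ⟨c, hc, e⟩ := h.slope_deriv (show y < y + 1 by linarith)
    obtain ⟨x, hx, e'⟩ := h.slope (show y + 1 < y + 2 by linarith)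
    have q := h.pos c
    have q₁ : ν y ≤ ν c := h.mono.monotone hc.1.le
    have q₂ : ν (y + 2) ≤ ν 1 := h.mono.monotone (by linarith)
    have q₃ := h.pos (y + 1)
    have q₄ := h.deriv_nonneg y
    have q₆ : 0 ≤ -(y + 1) := by linarith
    have q₇ := h.pos y
    have q₈ : (-(y + 1)) * ν y ≤ (-c) * ν c :=
      mul_le_mul (by linarith [hc.2]) q₁ q₇.le (by linarith [hc.2])
    have q₉ : 0 < ν c ^ 3 := by positivity
    have q₅ := h.deriv_mono_of_nonpos hx.1 (by linarith [hx.2])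
    nlinarith
  have q₁ : ν y ≤ ν 0 := h.mono.monotone (by linarith)
  have q₂ := h.pos y
  have q₃ : ν y ^ 3 ≤ ν 0 ^ 3 := by gcongr
  linarith

lemma deriv₂_bdd_atTop (h : IsHastingsMcLeod ν ν₁) {Y : ℝ} (hY4 : 4 ≤ Y)
    (hY : ∀ z ≥ Y, ν z ^ 2 ≤ z ∧ z ≤ 2 * ν z ^ 2) : ∃ B, ∀ z ≥ Y, z * ν z - ν z ^ 3 ≤ B := by
  obtain ⟨D, hD, hD'⟩ := h.deriv_bdd
  set K : ℝ := 16 * D ^ 2 + Y * (Y - ν Y ^ 2) with hK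
  have hK₁ : 0 ≤ Y * (Y - ν Y ^ 2) := mul_nonneg (by linarith) (by linarith [(hY Y le_rfl).1])
  have hK₀ : 0 < K := by positivity
  have key : ∀ z ≥ Y, (z - ν z ^ 2) - K / z ≤ 0 := by
    refine nonpos_of_sublinear_of_convex_where_pos
      (m₁ := fun z => (1 - 2 * ν z * ν₁ z) + K / z ^ 2)
      (m₂ := fun z => -2 * ν₁ z ^ 2 + ν z ^ 2 * (z - ν z ^ 2) / 2 - 2 * K / z ^ 3) ?_ ?_ ?_ ?_ ?_
    · intro z hz
      have hz0 : z ≠ 0 := by linarith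
      have := ((hasDerivAt_id z).sub ((h.deriv₁ z).pow 2)).sub ((hasDerivAt_inv hz0).const_mul K)
      refine (this.congr_deriv ?_).congr_of_eventuallyEq ?_
      · simp
        ring
      · exact Eventually.of_forall fun y => by simp [div_eq_mul_inv]
    · intro z hz
      have hz0 : z ≠ 0 := by linarith
      have hz2 : z ^ 2 ≠ 0 := by positivity
      have := ((((h.deriv₁ z).const_mul 2).mul (h.deriv₂ z)).const_sub 1).add
        ((((hasDerivAt_id z).pow 2).inv hz2).const_mul K)
      refine (this.congr_deriv ?_).congr_of_eventuallyEq ?_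
      · simp
        field_simp
        ring
      · exact Eventually.of_forall fun y => by simp [div_eq_mul_inv]
    · intro z hz hp
      have hz4 : 4 ≤ z := hY4.trans hz
      have q₁ : K / z < z - ν z ^ 2 := by linarith
      have q₂ := (hY z hz).2
      have q₃ : K / 4 ≤ ν z ^ 2 * (z - ν z ^ 2) / 2 := by
        have : z / 2 * (K / z) ≤ ν z ^ 2 * (z - ν z ^ 2) :=
          mul_le_mul (by linarith) q₁.le (by positivity) (sq_nonneg _)
        have e : z / 2 * (K / z) = K / 2 := by field_simp
        linarith
      have q₄ : 2 * K / z ^ 3 ≤ K / 32 := by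
        rw [div_le_iff₀ (by positivity)]
        have : (4:ℝ) ^ 3 ≤ z ^ 3 := by gcongr
        nlinarith
      have q₅ : ν₁ z ^ 2 ≤ D ^ 2 := pow_le_pow_left₀ (h.deriv_nonneg z) (hD' z) 2
      have : 0 < D ^ 2 := by positivity
      linarith
    · have : Y * (Y - ν Y ^ 2) / Y ≤ K / Y := by
        gcongr
        nlinarith
      rw [mul_div_cancel_left₀ _ (by linarith)] at this
      linarith
    · have t₁ := h.tendsto_sq_sub_div.neg
      have t₂ : Tendsto (fun z : ℝ => K * (z⁻¹ * z⁻¹)) atTop (𝓝 (K * (0 * 0))) :=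
        (tendsto_inv_atTop_zero.mul tendsto_inv_atTop_zero).const_mul K
      have t₃ := t₁.sub t₂
      simp only [mul_zero, neg_zero, sub_zero] at t₃
      refine t₃.congr fun z => ?_
      rw [div_eq_mul_inv, div_eq_mul_inv, div_eq_mul_inv]
      ring
  refine ⟨K, fun z hz => ?_⟩
  have hz4 : 4 ≤ z := hY4.trans hz
  have q₁ : (z - ν z ^ 2) ≤ K / z := by linarith [key z hz]
  have q₂ : ν z ≤ z := by
    have := (hY z hz).1
    nlinarith [h.pos z]
  have q₃ := h.pos z
  have e : z * ν z - ν z ^ 3 = ν z * (z - ν z ^ 2) := by ring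
  rw [e]
  calc ν z * (z - ν z ^ 2) ≤ z * (K / z) :=
        mul_le_mul q₂ q₁ (by linarith [(hY z hz).1]) (by linarith)
    _ = K := by field_simp

/-- All the quantitative information on the Hastings–McLeod solution used below. -/
lemma bounds (h : IsHastingsMcLeod ν ν₁) : ∃ B > 0, ∃ Y ≥ 4,
    (∀ y, ν₁ y ≤ B) ∧ (∀ y, |ν y ^ 3 - y * ν y| ≤ B) ∧
    (∀ z ≥ Y, ν z ^ 2 ≤ z ∧ z ≤ 2 * ν z ^ 2) ∧ (∀ z ≤ 0, ν₁ z ≤ B * (1 - z) * ν z) := by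
  obtain ⟨Y, hY4, hY⟩ := h.eventually_sq_le
  obtain ⟨B₁, hB₁, hB₁'⟩ := h.deriv_bdd
  obtain ⟨B₂, hB₂⟩ := h.deriv₂_bdd_nonpos
  obtain ⟨B₃, hB₃⟩ := h.deriv₂_bdd_atTop hY4 hY
  have hc : Continuous fun y => |ν y ^ 3 - y * ν y| := by
    have := h.continuous
    fun_prop
  obtain ⟨B₄, hB₄⟩ := (isCompact_Icc (a := -2) (b := Y)).bddAbove_image hc.continuousOn
  obtain ⟨C, hC, hC'⟩ := h.deriv_le_mul
  refine ⟨max B₁ (max B₂ (max B₃ (max B₄ C))), by positivity, Y, hY4,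
    fun y => (hB₁' y).trans (le_max_left _ _), fun y => ?_, hY, fun z hz => ?_⟩
  · rcases le_or_gt y (-2) with h₁ | h₁
    · rw [abs_of_nonneg]
      · exact (hB₂ y h₁).trans (by simp)
      · have : 0 < ν y ^ 3 := pow_pos (h.pos y) 3
        have : 0 ≤ -y * ν y := mul_nonneg (by linarith) (h.pos y).le
        linarith
    rcases le_or_gt y Y with h₂ | h₂
    · exact (hB₄ (mem_image_of_mem _ (⟨h₁.le, h₂⟩ : y ∈ Icc (-2) Y))).trans (by simp)
    · rw [abs_of_nonpos]
      · exact (by linarith [hB₃ y h₂.le] : _ ≤ B₃).trans (by simp)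
      · have : (ν y ^ 2 - y) * ν y ≤ 0 :=
          mul_nonpos_of_nonpos_of_nonneg (by linarith [(hY y h₂.le).1]) (h.pos y).le
        nlinarith
  · refine (hC' z hz).trans ?_
    have : C ≤ max B₁ (max B₂ (max B₃ (max B₄ C))) := by simp
    have := h.pos z
    gcongr
    linarith

end IsHastingsMcLeod

/-- The radial mean `½ ∫₀¹ σⁿ k(sσ²) dσ`. If `F' = radialMean n k`, then
`4 s F'' + 2 (n + 1) F' = k`, which says that `F(|x|²)` has Laplacian `k(|x|²)` in
dimension `n + 1`. -/
noncomputable def radialMean (n : ℕ) (k : ℝ → ℝ) (s : ℝ) : ℝ :=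
  (1 / 2) * ∫ σ in (0:ℝ)..1, σ ^ n * k (s * σ ^ 2)

lemma continuous_radialMean (n : ℕ) {k : ℝ → ℝ} (hk : Continuous k) :
    Continuous (radialMean n k) := by
  unfold radialMean
  refine continuous_const.mul ?_
  exact intervalIntegral.continuous_parametric_intervalIntegral_of_continuous
    (f := fun s σ => σ ^ n * k (s * σ ^ 2)) (by unfold Function.uncurry; fun_prop) continuous_const

lemma radialMean_sub (n : ℕ) {k l : ℝ → ℝ} (hk : Continuous k) (hl : Continuous l) (s : ℝ) :
    radialMean n (fun t => k t - l t) s = radialMean n k s - radialMean n l s := by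
  unfold radialMean
  rw [← mul_sub, ← intervalIntegral.integral_sub]
  · simp only [mul_sub]
  · exact Continuous.intervalIntegrable (by fun_prop) _ _
  · exact Continuous.intervalIntegrable (by fun_prop) _ _

lemma abs_radialMean_le (n : ℕ) {k : ℝ → ℝ} {s M : ℝ} (hs : 0 ≤ s)
    (hM : ∀ t, 0 ≤ t → t ≤ s → |k t| ≤ M) : |radialMean n k s| ≤ M / 2 := by
  have : ‖∫ σ in (0:ℝ)..1, σ ^ n * k (s * σ ^ 2)‖ ≤ M * |1 - 0| := by
    refine intervalIntegral.norm_integral_le_of_norm_le_const fun σ hσ => ?_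
    rw [uIoc_of_le zero_le_one] at hσ
    have h₁ : σ ^ 2 ≤ 1 := pow_le_one₀ hσ.1.le hσ.2
    have h₂ := hM (s * σ ^ 2) (by positivity) (by nlinarith)
    have h₃ : σ ^ n ≤ 1 := pow_le_one₀ hσ.1.le hσ.2
    have h₄ : 0 ≤ σ ^ n := pow_nonneg hσ.1.le n
    rw [Real.norm_eq_abs, abs_mul, abs_of_nonneg h₄]
    nlinarith [abs_nonneg (k (s * σ ^ 2))]
  rw [Real.norm_eq_abs] at this
  unfold radialMean
  rw [abs_mul, abs_of_pos (by norm_num : (0:ℝ) < 1 / 2)]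
  simp at this
  linarith

lemma radialMean_congr (n : ℕ) {k l : ℝ → ℝ} {s : ℝ} (hs : 0 ≤ s)
    (h : ∀ t ≥ 0, k t = l t) : radialMean n k s = radialMean n l s := by
  unfold radialMean
  congr 2
  ext σ
  rw [h _ (by positivity)]

/-- The radial mean inverts the radial Laplacian. -/
lemma radialMean_radialLaplacian (n : ℕ) {w₁ w₂ : ℝ → ℝ} (h : ∀ s, HasDerivAt w₁ (w₂ s) s)
    (hc : Continuous w₂) (s : ℝ) :
    radialMean n (fun t => 4 * t * w₂ t + 2 * (n + 1) * w₁ t) s = w₁ s := by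
  have hc₁ : Continuous w₁ := continuous_iff_continuousAt.2 fun s => (h s).continuousAt
  have key : ∀ σ : ℝ, HasDerivAt (fun σ => σ ^ (n + 1) * w₁ (s * σ ^ 2))
      (1 / 2 * (σ ^ n * (4 * (s * σ ^ 2) * w₂ (s * σ ^ 2) + 2 * (n + 1) * w₁ (s * σ ^ 2)))) σ := by
    intro σ
    have e₁ : HasDerivAt (fun σ : ℝ => s * σ ^ 2) (s * (2 * σ)) σ := by
      simpa using (hasDerivAt_pow 2 σ).const_mul s
    have e₂ := (hasDerivAt_pow (n + 1) σ).mul ((h (s * σ ^ 2)).comp σ e₁)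
    refine e₂.congr_deriv ?_
    simp
    ring
  unfold radialMean
  rw [← intervalIntegral.integral_const_mul,
    intervalIntegral.integral_eq_sub_of_hasDerivAt (fun σ _ => key σ)]
  · simp
  · exact Continuous.intervalIntegrable (by fun_prop) _ _

lemma hasDerivAt_radialMean (n : ℕ) {k k₁ : ℝ → ℝ} (h : ∀ s, HasDerivAt k (k₁ s) s)
    (hc : Continuous k₁) (s : ℝ) :
    HasDerivAt (radialMean n k) (radialMean (n + 2) k₁ s) s := by
  have hk : Continuous k := continuous_iff_continuousAt.2 fun s => (h s).continuousAt
  obtain ⟨M, hM⟩ := (isCompact_Icc (a := -(|s| + 1)) (b := |s| + 1)).exists_bound_of_continuousOn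
    hc.continuousOn
  refine HasDerivAt.const_mul (1 / 2 : ℝ)
    (intervalIntegral.hasDerivAt_integral_of_dominated_loc_of_deriv_le
    (F := fun x σ => σ ^ n * k (x * σ ^ 2)) (F' := fun x σ => σ ^ (n + 2) * k₁ (x * σ ^ 2))
    (s := Metric.ball s 1) (bound := fun _ => M) (Metric.ball_mem_nhds s one_pos)
    (Eventually.of_forall fun x => ?_) ?_ ?_ (Eventually.of_forall fun σ hσ x hx => ?_) ?_
    (Eventually.of_forall fun σ hσ x hx => ?_)).2
  · exact Continuous.aestronglyMeasurable (by fun_prop)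
  · exact Continuous.intervalIntegrable (by fun_prop) _ _
  · exact Continuous.aestronglyMeasurable (by fun_prop)
  · rw [uIoc_of_le zero_le_one] at hσ
    rw [Metric.mem_ball, Real.dist_eq] at hx
    have hx' : |x| ≤ |s| + 1 := by
      have := abs_sub_abs_le_abs_sub x s
      linarith
    have hσ2 : σ ^ 2 ≤ 1 := pow_le_one₀ hσ.1.le hσ.2
    have hle : |x * σ ^ 2| ≤ |s| + 1 := by
      rw [abs_mul, abs_of_nonneg (sq_nonneg σ)]
      nlinarith [abs_nonneg x]
    have h₂ := hM (x * σ ^ 2) (abs_le.1 hle)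
    have h₃ : σ ^ (n + 2) ≤ 1 := pow_le_one₀ hσ.1.le hσ.2
    have h₄ : 0 ≤ σ ^ (n + 2) := pow_nonneg hσ.1.le _
    rw [norm_mul, Real.norm_of_nonneg h₄]
    nlinarith [norm_nonneg (k₁ (x * σ ^ 2))]
  · exact intervalIntegrable_const
  · have e₁ : HasDerivAt (fun x : ℝ => x * σ ^ 2) (σ ^ 2) x := by
      simpa using (hasDerivAt_id x).mul_const (σ ^ 2)
    refine (((h (x * σ ^ 2)).comp x e₁).const_mul (σ ^ n)).congr_deriv ?_
    ring

lemma radialLaplacian_radialMean (n : ℕ) {k k₁ : ℝ → ℝ} (h : ∀ s, HasDerivAt k (k₁ s) s)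
    (hc : Continuous k₁) (s : ℝ) :
    4 * s * radialMean (n + 2) k₁ s + 2 * (n + 1) * radialMean n k s = k s := by
  have hk : Continuous k := continuous_iff_continuousAt.2 fun s => (h s).continuousAt
  have key : ∀ σ : ℝ, HasDerivAt (fun σ => σ ^ (n + 1) * k (s * σ ^ 2))
      (2 * s * (σ ^ (n + 2) * k₁ (s * σ ^ 2)) + (n + 1) * (σ ^ n * k (s * σ ^ 2))) σ := by
    intro σ
    have e₁ : HasDerivAt (fun σ : ℝ => s * σ ^ 2) (s * (2 * σ)) σ := by
      simpa using (hasDerivAt_pow 2 σ).const_mul s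
    have e₂ := (hasDerivAt_pow (n + 1) σ).mul ((h (s * σ ^ 2)).comp σ e₁)
    refine e₂.congr_deriv ?_
    simp
    ring
  have e := intervalIntegral.integral_eq_sub_of_hasDerivAt (a := 0) (b := 1) (fun σ _ => key σ)
    (Continuous.intervalIntegrable (by fun_prop) _ _)
  rw [intervalIntegral.integral_add, intervalIntegral.integral_const_mul,
    intervalIntegral.integral_const_mul] at e
  · simp at e
    unfold radialMean
    linarith
  · exact Continuous.intervalIntegrable (by fun_prop) _ _
  · exact Continuous.intervalIntegrable (by fun_prop) _ _

lemma pow_mul_radialMean (n : ℕ) (k : ℝ → ℝ) (r : ℝ) :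
    r ^ (n + 1) * radialMean n k (r ^ 2) = (1 / 2) * ∫ ρ in (0:ℝ)..r, ρ ^ n * k (ρ ^ 2) := by
  have e := intervalIntegral.smul_integral_comp_mul_right (a := 0) (b := 1)
    (fun ρ => ρ ^ n * k (ρ ^ 2)) r
  rw [zero_mul, one_mul] at e
  unfold radialMean
  rw [← e, smul_eq_mul, mul_left_comm, pow_succ, mul_assoc, ← mul_assoc (r ^ n), mul_comm (r ^ n),
    mul_assoc, ← intervalIntegral.integral_const_mul]
  congr 4
  ext σ
  rw [mul_pow, mul_pow, mul_comm (σ ^ 2)]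
  ring

/-- Weak maximum principle for the radial Laplacian on a ball. -/
lemma radial_maximum_principle (n : ℕ) {D m : ℝ → ℝ} {R : ℝ} (hm : Continuous m)
    (hD : ∀ s, HasDerivAt D (radialMean n m s) s)
    (hpos : ∀ s, 0 ≤ s → s ≤ R → 0 < D s → 0 < m s) (hR : D R ≤ 0) :
    ∀ s, 0 ≤ s → s ≤ R → D s ≤ 0 := by
  intro s hs hsR
  by_contra! hcon
  have hDc : Continuous D := continuous_iff_continuousAt.2 fun s => (hD s).continuousAt
  obtain ⟨ξ, hξ, hmax⟩ := isCompact_Icc.exists_isMaxOn ⟨s, ⟨hs, hsR⟩⟩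
    (hDc.continuousOn (s := Icc 0 R))
  have hξpos : 0 < D ξ := lt_of_lt_of_le hcon (hmax (⟨hs, hsR⟩ : s ∈ Icc 0 R))
  have hξR : ξ < R := by
    rcases hξ.2.eq_or_lt with h | h
    · rw [h] at hξpos; linarith
    · exact h
  obtain ⟨b, hb, hbpos⟩ : ∃ b > ξ, ∀ t ∈ Ioo ξ b, 0 < D t ∧ t < R := by
    have : ∀ᶠ t in 𝓝[>] ξ, 0 < D t ∧ t < R := nhdsWithin_le_nhds
      ((hDc.continuousAt.eventually (lt_mem_nhds hξpos)).and (gt_mem_nhds hξR))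
    obtain ⟨b, hb, hb'⟩ := mem_nhdsGT_iff_exists_Ioo_subset.1 this
    exact ⟨b, hb, hb'⟩
  have hder : ∀ t ∈ Ioo ξ b, 0 < radialMean n m t := by
    intro t ht
    have h0t : 0 < t := lt_of_le_of_lt hξ.1 ht.1
    have e₀ : √ξ ^ (n + 1) * radialMean n m (√ξ ^ 2) = 0 := by
      rcases hξ.1.eq_or_lt with h | h
      · rw [← h]; simp
      · rw [Real.sq_sqrt hξ.1]
        have : IsLocalMax D ξ := hmax.isLocalMax (Icc_mem_nhds h hξR)
        rw [← (hD ξ).deriv, this.deriv_eq_zero, mul_zero]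
    have e₁ : √t ^ (n + 1) * radialMean n m (√t ^ 2) = (1 / 2) * ∫ ρ in √ξ..√t, ρ ^ n * m (ρ ^ 2) := by
      rw [pow_mul_radialMean] at e₀ ⊢
      rw [← intervalIntegral.integral_add_adjacent_intervals (b := √ξ)]
      · linarith
      · exact Continuous.intervalIntegrable (by fun_prop) _ _
      · exact Continuous.intervalIntegrable (by fun_prop) _ _
    have e₂ : 0 < ∫ ρ in √ξ..√t, ρ ^ n * m (ρ ^ 2) := by
      refine intervalIntegral.intervalIntegral_pos_of_pos_on
        (Continuous.intervalIntegrable (by fun_prop) _ _) (fun ρ hρ => ?_)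
        (Real.sqrt_lt_sqrt hξ.1 ht.1)
      have hρ0 : 0 < ρ := lt_of_le_of_lt (Real.sqrt_nonneg _) hρ.1
      have h₁ : ξ < ρ ^ 2 := (Real.sqrt_lt' hρ0).1 hρ.1
      have h₂ : ρ ^ 2 < t := (Real.lt_sqrt hρ0.le).1 hρ.2
      have h₃ := hbpos (ρ ^ 2) ⟨h₁, h₂.trans ht.2⟩
      exact mul_pos (pow_pos hρ0 n) (hpos _ (by positivity) h₃.2.le h₃.1)
    rw [Real.sq_sqrt h0t.le] at e₁
    have : 0 < √t ^ (n + 1) := by positivity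
    by_contra! hneg
    nlinarith
  have hc : (ξ + b) / 2 ∈ Ioo ξ b := ⟨by linarith, by linarith⟩
  obtain ⟨x, hx, e⟩ := exists_hasDerivAt_eq_slope D _ hc.1 hDc.continuousOn fun t _ => hD t
  have p := hder x ⟨hx.1, hx.2.trans hc.2⟩
  rw [e] at p
  have q : D ((ξ + b) / 2) ≤ D ξ :=
    hmax (⟨by linarith [hξ.1, hc.1], (hbpos _ hc).2.le⟩ : (ξ + b) / 2 ∈ Icc 0 R)
  have : (D ((ξ + b) / 2) - D ξ) / ((ξ + b) / 2 - ξ) ≤ 0 :=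
    div_nonpos_of_nonpos_of_nonneg (by linarith) (by linarith [hc.1])
  linarith

lemma abs_integral_le_of_weight {L M : ℝ} {g : ℝ → ℝ}
    (hg : ∀ t ≥ 0, |g t| ≤ M * (L * (1 + t) * Real.exp (L * (1 + t) ^ 2)) / 2) (hM : 0 ≤ M)
    {s : ℝ} (hs : 0 ≤ s) :
    |∫ t in (0:ℝ)..s, g t| ≤ M / 4 * Real.exp (L * (1 + s) ^ 2) := by
  have hd : ∀ t : ℝ, HasDerivAt (fun t => M / 4 * Real.exp (L * (1 + t) ^ 2))
      (M * (L * (1 + t) * Real.exp (L * (1 + t) ^ 2)) / 2) t := by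
    intro t
    have e₁ : HasDerivAt (fun t : ℝ => L * (1 + t) ^ 2) (L * (2 * (1 + t))) t := by
      simpa using (((hasDerivAt_id t).const_add 1).pow 2).const_mul L
    refine (e₁.exp.const_mul (M / 4)).congr_deriv ?_
    ring
  have hi : IntervalIntegrable (fun t => M * (L * (1 + t) * Real.exp (L * (1 + t) ^ 2)) / 2)
      volume 0 s := Continuous.intervalIntegrable (by fun_prop) _ _
  have e := intervalIntegral.integral_eq_sub_of_hasDerivAt (fun t _ => hd t) hi
  have b := intervalIntegral.norm_integral_le_of_norm_le hs (f := g) (μ := volume)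
    (Eventually.of_forall fun t ht => hg t ht.1.le) hi
  rw [e] at b
  rw [Real.norm_eq_abs] at b
  have : 0 ≤ M / 4 * Real.exp (L * (1 + 0) ^ 2) := by positivity
  linarith

open scoped BoundedContinuousFunction in
/-- Global solvability of the radial initial value problem, with continuous dependence on the
initial value. -/
lemma exists_radial_flow (n : ℕ) {K : ℝ → ℝ → ℝ} (hK : Continuous (Function.uncurry K)) {L : ℝ}
    (hL : 0 < L) (hlip : ∀ s ≥ 0, ∀ u v, |K s u - K s v| ≤ L * (1 + s) * |u - v|)
    (hb : ∀ s ≥ 0, ∀ u, |K s u| ≤ L * (1 + s)) :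
    ∃ f : ℝ → ℝ → ℝ, (∀ a, Continuous (f a)) ∧ (∀ s, Continuous fun a => f a s) ∧
      ∀ a, ∀ s ≥ 0, f a s = a + ∫ t in (0:ℝ)..s, radialMean n (fun t => K t (f a t)) t := by
  set E : ℝ → ℝ := fun s => Real.exp (L * (1 + s) ^ 2) with hE
  have hEpos : ∀ s, 0 < E s := fun s => Real.exp_pos _
  have hEc : Continuous E := by fun_prop
  have hE1 : ∀ s, 1 ≤ E s := fun s => Real.one_le_exp (by positivity)
  have hkc : ∀ u : ℝ → ℝ, Continuous u → Continuous fun t => K t (u t) := fun u hu =>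
    hK.comp (continuous_id.prodMk hu)
  have hIc : ∀ u : ℝ → ℝ, Continuous u →
      Continuous fun s => ∫ t in (0:ℝ)..s, radialMean n (fun t => K t (u t)) t := fun u hu =>
    intervalIntegral.continuous_primitive
      (fun a b => (continuous_radialMean n (hkc u hu)).intervalIntegrable a b) 0
  have hIb : ∀ u : ℝ → ℝ, ∀ s ≥ 0,
      |∫ t in (0:ℝ)..s, radialMean n (fun t => K t (u t)) t| ≤ 1 / 4 * E s := by
    intro u s hs
    refine abs_integral_le_of_weight (fun t ht => ?_) zero_le_one hs
    refine abs_radialMean_le n ht fun τ hτ hτt => (hb τ hτ _).trans ?_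
    have h₁ : L * (1 + τ) ≤ L * (1 + t) := by gcongr
    have h₂ : L * (1 + t) * 1 ≤ L * (1 + t) * E t := by gcongr; exact hE1 t
    simp only [hE] at h₂
    linarith
  let T : ℝ → (ℝ →ᵇ ℝ) → (ℝ →ᵇ ℝ) := fun a u => BoundedContinuousFunction.ofNormedAddCommGroup
    (fun s => (E (max s 0))⁻¹ *
      (a + ∫ t in (0:ℝ)..max s 0, radialMean n (fun t => K t (E t * u t)) t))
    (by
      have h₁ := hIc (fun t => E t * u t) (hEc.mul u.continuous)
      have h₂ : Continuous fun s : ℝ => max s 0 := by fun_prop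
      exact ((hEc.comp h₂).inv₀ fun s => (hEpos _).ne').mul (continuous_const.add (h₁.comp h₂)))
    (|a| + 1 / 4)
    (by
      intro s
      have h₁ := hIb (fun t => E t * u t) (max s 0) (le_max_right _ _)
      rw [Real.norm_eq_abs, abs_mul, abs_of_pos (inv_pos.2 (hEpos _)),
        inv_mul_le_iff₀ (hEpos _)]
      refine (abs_add_le _ _).trans ?_
      nlinarith [hE1 (max s 0), abs_nonneg a])
  have hT : ∀ a (u : ℝ →ᵇ ℝ) s, T a u s = (E (max s 0))⁻¹ *
      (a + ∫ t in (0:ℝ)..max s 0, radialMean n (fun t => K t (E t * u t)) t) := fun a u s => rfl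
  have hcontr : ∀ a, ContractingWith (1 / 4) (T a) := by
    intro a
    refine ⟨by norm_num, LipschitzWith.of_dist_le_mul fun u v => ?_⟩
    rw [BoundedContinuousFunction.dist_le (by positivity)]
    intro s
    rw [hT, hT, Real.dist_eq, ← mul_sub, abs_mul, abs_of_pos (inv_pos.2 (hEpos _)),
      inv_mul_le_iff₀ (hEpos _), add_sub_add_left_eq_sub, ← intervalIntegral.integral_sub]
    · have := abs_integral_le_of_weight (L := L) (M := dist u v) (g := fun t =>
        radialMean n (fun t => K t (E t * u t)) t - radialMean n (fun t => K t (E t * v t)) t)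
        (fun t ht => ?_) dist_nonneg (le_max_right s 0)
      · simp only [NNReal.coe_div, NNReal.coe_one, NNReal.coe_ofNat]
        refine this.trans (le_of_eq ?_)
        simp only [hE]
        ring
      · rw [← radialMean_sub n (k := fun t => K t (E t * u t)) (l := fun t => K t (E t * v t))
          (hkc _ (hEc.mul u.continuous)) (hkc _ (hEc.mul v.continuous))]
        refine abs_radialMean_le n ht fun τ hτ hτt => (hlip τ hτ _ _).trans ?_
        have h₁ : L * (1 + τ) ≤ L * (1 + t) := by gcongr
        have h₂ : E τ ≤ E t := by
          simp only [hE]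
          gcongr
        have h₃ : |u τ - v τ| ≤ dist u v := by
          rw [← Real.dist_eq]
          exact BoundedContinuousFunction.dist_coe_le_dist τ
        rw [← mul_sub, abs_mul, abs_of_pos (hEpos τ)]
        calc L * (1 + τ) * (E τ * |u τ - v τ|) ≤ L * (1 + t) * (E t * dist u v) := by
              have := hEpos τ
              gcongr
          _ = _ := by simp only [hE]; ring
    · exact (continuous_radialMean n (hkc _ (hEc.mul u.continuous))).intervalIntegrable _ _
    · exact (continuous_radialMean n (hkc _ (hEc.mul v.continuous))).intervalIntegrable _ _
  let U : ℝ → (ℝ →ᵇ ℝ) := fun a => ContractingWith.fixedPoint (T a) (hcontr a)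
  have hU : ∀ a, T a (U a) = U a := fun a => (hcontr a).fixedPoint_isFixedPt
  have hUlip : ∀ a b, dist (U a) (U b) ≤ 2 * dist a b := by
    intro a b
    have := ContractingWith.fixedPoint_lipschitz_in_map (hcontr a) (hcontr b) (C := dist a b)
      fun u => by
        rw [BoundedContinuousFunction.dist_le dist_nonneg]
        intro s
        rw [hT, hT, Real.dist_eq, ← mul_sub, abs_mul, abs_of_pos (inv_pos.2 (hEpos _)),
          inv_mul_le_iff₀ (hEpos _), add_sub_add_right_eq_sub, Real.dist_eq]
        nlinarith [hE1 (max s 0), abs_nonneg (a - b)]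
    refine this.trans ?_
    have := dist_nonneg (x := a) (y := b)
    norm_num
    linarith
  have hUc : Continuous U :=
    (LipschitzWith.of_dist_le_mul (K := 2) (by simpa using hUlip)).continuous
  refine ⟨fun a s => E s * U a s, fun a => hEc.mul (U a).continuous, fun s =>
    continuous_const.mul ((continuous_eval_const s).comp hUc),
    fun a s hs => ?_⟩
  have := hT a (U a) s
  rw [hU, max_eq_left hs] at this
  simp only
  nth_rewrite 1 [this]
  rw [← mul_assoc, mul_inv_cancel₀ (hEpos s).ne', one_mul]

/-- A function on the half-line with `F' = radialMean n k`, where `k` is a smooth function of `s`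
and `F`, extends to a `C²` function which solves the radial Poisson equation. -/
lemma exists_contDiff_of_integral_eq (n : ℕ) {Q : ℝ → ℝ → ℝ}
    (hQ : ContDiff ℝ 1 (Function.uncurry Q)) {f k : ℝ → ℝ} {a : ℝ} (hk : Continuous k)
    (hf : ∀ s ≥ 0, f s = a + ∫ t in (0:ℝ)..s, radialMean n k t)
    (hkQ : ∀ s ≥ 0, k s = Q s (f s)) :
    ∃ F : ℝ → ℝ, ContDiff ℝ 2 F ∧ (∀ s ≥ 0, F s = f s) ∧
      ∀ s ≥ 0, 4 * s * deriv (deriv F) s + 2 * (n + 1) * deriv F s = Q s (F s) := by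
  have hprim : ∀ l : ℝ → ℝ, Continuous l → ∀ s,
      HasDerivAt (fun s => a + ∫ t in (0:ℝ)..s, radialMean n l t) (radialMean n l s) s := by
    intro l hl s
    exact ((continuous_radialMean n hl).integral_hasStrictDerivAt 0 s).hasDerivAt.const_add a
  set G : ℝ → ℝ := fun s => a + ∫ t in (0:ℝ)..s, radialMean n k t with hG
  have hGC : ContDiff ℝ 1 G := by
    rw [contDiff_one_iff_deriv]
    refine ⟨fun s => (hprim k hk s).differentiableAt, ?_⟩
    rw [show deriv G = radialMean n k from funext fun s => (hprim k hk s).deriv]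
    exact continuous_radialMean n hk
  have hlC : ContDiff ℝ 1 fun s => Q s (G s) := hQ.comp (contDiff_id.prodMk hGC)
  set l : ℝ → ℝ := fun s => Q s (G s) with hl
  have hl' : ∀ s, HasDerivAt l (deriv l s) s := fun s =>
    ((hlC.differentiable (by norm_num)) s).hasDerivAt
  have hlc : Continuous (deriv l) := (contDiff_one_iff_deriv.1 hlC).2
  have hkl : ∀ s ≥ 0, k s = l s := fun s hs => by rw [hkQ s hs, hl, hf s hs]
  have hF₁ : deriv (fun s => a + ∫ t in (0:ℝ)..s, radialMean n l t) = radialMean n l :=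
    funext fun s => (hprim l hlC.continuous s).deriv
  have hF₂ : deriv (radialMean n l) = radialMean (n + 2) (deriv l) :=
    funext fun s => (hasDerivAt_radialMean n hl' hlc s).deriv
  have hFG : ∀ s ≥ 0, a + ∫ t in (0:ℝ)..s, radialMean n l t = G s := by
    intro s hs
    simp only [hG]
    congr 1
    refine intervalIntegral.integral_congr fun t ht => ?_
    rw [uIcc_of_le hs] at ht
    exact (radialMean_congr n ht.1 hkl).symm
  refine ⟨fun s => a + ∫ t in (0:ℝ)..s, radialMean n l t, ?_, fun s hs => ?_, fun s hs => ?_⟩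
  · rw [show (2 : WithTop ℕ∞) = 1 + 1 by norm_num, contDiff_succ_iff_deriv, hF₁]
    refine ⟨fun s => (hprim l hlC.continuous s).differentiableAt, by simp, ?_⟩
    rw [contDiff_one_iff_deriv, hF₂]
    exact ⟨fun s => (hasDerivAt_radialMean n hl' hlc s).differentiableAt,
      continuous_radialMean _ hlc⟩
  · simp only [hFG s hs, hf s hs, hG]
  · rw [hF₁, hF₂, radialLaplacian_radialMean n hl' hlc]
    exact congrArg (Q s) (hFG s hs).symm

/-- Existence of a radial solution of the Gross–Pitaevskii equation between strict radial
sub- and supersolutions `v < w`, in the variable `s = |x|²` and in dimension `n + 1`. -/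
theorem exists_solution_between (n : ℕ) {A W : ℝ} (hA : 0 < A) {v v₁ v₂ w w₁ w₂ : ℝ → ℝ}
    (hv₁ : ∀ s, HasDerivAt v (v₁ s) s) (hv₂ : ∀ s, HasDerivAt v₁ (v₂ s) s) (hv₂c : Continuous v₂)
    (hw₁ : ∀ s, HasDerivAt w (w₁ s) s) (hw₂ : ∀ s, HasDerivAt w₁ (w₂ s) s) (hw₂c : Continuous w₂)
    (hv : ∀ s, 0 < v s) (hvw : ∀ s, v s < w s) (hW : ∀ s ≥ 0, w s ≤ W)
    (hsub : ∀ s ≥ 0, A * (v s ^ 3 - (1 - s) * v s) < 4 * s * v₂ s + 2 * (n + 1) * v₁ s)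
    (hsup : ∀ s ≥ 0, 4 * s * w₂ s + 2 * (n + 1) * w₁ s < A * (w s ^ 3 - (1 - s) * w s)) :
    ∃ F : ℝ → ℝ, ContDiff ℝ 2 F ∧ (∀ s ≥ 0, v s ≤ F s ∧ F s ≤ w s) ∧
      ∀ s ≥ 0, 4 * s * deriv (deriv F) s + 2 * (n + 1) * deriv F s =
        A * (F s ^ 3 - (1 - s) * F s) := by
  have hvc : Continuous v := continuous_iff_continuousAt.2 fun s => (hv₁ s).continuousAt
  have hv₁c : Continuous v₁ := continuous_iff_continuousAt.2 fun s => (hv₂ s).continuousAt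
  have hwc : Continuous w := continuous_iff_continuousAt.2 fun s => (hw₁ s).continuousAt
  have hw₁c : Continuous w₁ := continuous_iff_continuousAt.2 fun s => (hw₂ s).continuousAt
  set q : ℝ → ℝ → ℝ := fun s u => max (v s) (min u (w s)) with hq
  set K : ℝ → ℝ → ℝ := fun s u => A * (q s u ^ 3 - (1 - s) * q s u) with hKdef
  have hK : Continuous (Function.uncurry K) := by
    have : Continuous (Function.uncurry q) :=
      (hvc.comp continuous_fst).max (continuous_snd.min (hwc.comp continuous_fst))
    simp only [hKdef, Function.uncurry_def] at this ⊢
    fun_prop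
  have hq0 : ∀ s u, 0 < q s u := fun s u => lt_of_lt_of_le (hv s) (le_max_left _ _)
  have hqW : ∀ s ≥ 0, ∀ u, q s u ≤ W := fun s hs u =>
    (max_le (hvw s).le (min_le_right _ _)).trans (hW s hs)
  have hqlip : ∀ s u u', |q s u - q s u'| ≤ |u - u'| := by
    intro s u u'
    have h₁ := abs_max_sub_max_le_max (v s) (min u (w s)) (v s) (min u' (w s))
    have h₂ := abs_min_sub_min_le_max u (w s) u' (w s)
    rw [sub_self, abs_zero] at h₁ h₂
    rw [max_eq_right (a := (0:ℝ)) (abs_nonneg _)] at h₁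
    rw [max_eq_left (b := (0:ℝ)) (abs_nonneg _)] at h₂
    exact h₁.trans h₂
  have hW0 : 0 < W := (hv 0).trans ((hvw 0).trans_le (hW 0 le_rfl))
  set L : ℝ := A * (3 * W ^ 2 + 1 + W ^ 3 + W) with hL
  have hL0 : 0 < L := by positivity
  have hlip : ∀ s ≥ 0, ∀ u u', |K s u - K s u'| ≤ L * (1 + s) * |u - u'| := by
    intro s hs u u'
    have e : K s u - K s u' = A * ((q s u ^ 2 + q s u * q s u' + q s u' ^ 2 - (1 - s)) *
        (q s u - q s u')) := by
      simp only [hKdef]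
      ring
    rw [e, abs_mul, abs_of_pos hA, abs_mul, ← mul_assoc]
    refine mul_le_mul ?_ (hqlip s u u') (abs_nonneg _) (by positivity)
    rw [hL, mul_assoc]
    refine mul_le_mul_of_nonneg_left ?_ hA.le
    have a₁ := hq0 s u
    have a₂ := hq0 s u'
    have a₃ := hqW s hs u
    have a₄ := hqW s hs u'
    have a₅ : 0 < q s u * q s u' := by positivity
    have a₆ : q s u * q s u' ≤ W * W := by gcongr
    have a₇ : q s u ^ 2 ≤ W ^ 2 := by gcongr
    have a₈ : q s u' ^ 2 ≤ W ^ 2 := by gcongr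
    have a₉ : 0 < W ^ 3 := by positivity
    have b₁ : 0 ≤ (3 * W ^ 2 + W ^ 3 + W) * s := by positivity
    rw [abs_le]
    constructor <;> nlinarith [sq_nonneg (q s u), sq_nonneg (q s u')]
  have hb : ∀ s ≥ 0, ∀ u, |K s u| ≤ L * (1 + s) := by
    intro s hs u
    simp only [hKdef]
    rw [abs_mul, abs_of_pos hA, hL, mul_assoc]
    refine mul_le_mul_of_nonneg_left ?_ hA.le
    have a₁ := hq0 s u
    have a₃ := hqW s hs u
    have a₄ : q s u ^ 3 ≤ W ^ 3 := by gcongr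
    have a₅ : 0 < q s u ^ 3 := by positivity
    have a₆ : q s u * s ≤ W * s := by gcongr
    have a₇ : 0 ≤ q s u * s := by positivity
    have b₁ : 0 ≤ (3 * W ^ 2 + 1 + W ^ 3) * s := by positivity
    have b₂ : 0 < W ^ 2 := by positivity
    rw [abs_le]
    constructor <;> nlinarith
  obtain ⟨f, hfc, hfa, hf⟩ := exists_radial_flow n hK hL0 hlip hb
  have hkc : ∀ a, Continuous fun t => K t (f a t) := fun a =>
    hK.comp (continuous_id.prodMk (hfc a))
  have hprim : ∀ a s, HasDerivAt (fun s => a + ∫ t in (0:ℝ)..s,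
      radialMean n (fun t => K t (f a t)) t) (radialMean n (fun t => K t (f a t)) s) s := by
    intro a s
    exact ((continuous_radialMean n (hkc a)).integral_hasStrictDerivAt 0 s).hasDerivAt.const_add a
  have hbetween : ∀ a R, v R ≤ f a R → f a R ≤ w R → 0 ≤ R →
      ∀ s, 0 ≤ s → s ≤ R → v s ≤ f a s ∧ f a s ≤ w s := by
    intro a R h₁ h₂ hR s hs hsR
    constructor
    · have := radial_maximum_principle n (R := R)
        (D := fun s => v s - (a + ∫ t in (0:ℝ)..s, radialMean n (fun t => K t (f a t)) t))
        (m := fun s => (4 * s * v₂ s + 2 * (n + 1) * v₁ s) - K s (f a s))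
        (Continuous.sub (by fun_prop) (hkc a)) (fun s => ?_) (fun t ht htR hD => ?_) ?_ s hs hsR
      · rw [← hf a s hs] at this
        linarith
      · rw [radialMean_sub n (by fun_prop) (hkc a), radialMean_radialLaplacian n hv₂ hv₂c]
        exact (hv₁ s).sub (hprim a s)
      · rw [← hf a t ht] at hD
        have e : q t (f a t) = v t := max_eq_left ((min_le_left _ _).trans (by linarith))
        simp only [hKdef, e]
        linarith [hsub t ht]
      · rw [← hf a R hR]
        linarith
    · have := radial_maximum_principle n (R := R)
        (D := fun s => (a + ∫ t in (0:ℝ)..s, radialMean n (fun t => K t (f a t)) t) - w s)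
        (m := fun s => K s (f a s) - (4 * s * w₂ s + 2 * (n + 1) * w₁ s))
        (Continuous.sub (hkc a) (by fun_prop)) (fun s => ?_) (fun t ht htR hD => ?_) ?_ s hs hsR
      · rw [← hf a s hs] at this
        linarith
      · rw [radialMean_sub n (hkc a) (by fun_prop), radialMean_radialLaplacian n hw₂ hw₂c]
        exact (hprim a s).sub (hw₁ s)
      · rw [← hf a t ht] at hD
        have e : q t (f a t) = w t := by
          simp only [hq]
          rw [min_eq_right (by linarith), max_eq_right (hvw t).le]
        simp only [hKdef, e]
        linarith [hsup t ht]
      · rw [← hf a R hR]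
        linarith
  have hexists : ∀ R ≥ 0, ∃ a, v R ≤ f a R ∧ f a R ≤ w R := by
    intro R hR
    set C : ℝ := L * (1 + R) / 2 * |R - 0| with hC
    have hC0 : 0 ≤ C := by positivity
    have hclose : ∀ a, |f a R - a| ≤ C := by
      intro a
      rw [hf a R hR, add_sub_cancel_left, ← Real.norm_eq_abs]
      refine intervalIntegral.norm_integral_le_of_norm_le_const fun t ht => ?_
      rw [uIoc_of_le hR] at ht
      refine abs_radialMean_le n ht.1.le fun τ hτ hτt => (hb τ hτ _).trans ?_
      have : τ ≤ R := hτt.trans ht.2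
      gcongr
    set M := (v R + w R) / 2 with hM
    have hIVT := intermediate_value_Icc (show M - C ≤ M + C by linarith) (hfa R).continuousOn
    obtain ⟨a, -, ha⟩ := hIVT (show M ∈ Icc _ _ from
      ⟨by linarith [(abs_le.1 (hclose (M - C))).2], by linarith [(abs_le.1 (hclose (M + C))).1]⟩)
    have := hvw R
    simp only at ha
    exact ⟨a, by rw [ha]; linarith, by rw [ha]; linarith⟩
  let S : ℕ → Set ℝ := fun j => {a | ∀ s ∈ Icc (0:ℝ) j, v s ≤ f a s ∧ f a s ≤ w s}
  have hSclosed : ∀ j, IsClosed (S j) := by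
    intro j
    have : S j = ⋂ s ∈ Icc (0:ℝ) j, {a | v s ≤ f a s} ∩ {a | f a s ≤ w s} := by
      ext a
      simp [S]
    rw [this]
    exact isClosed_biInter fun s _ => (isClosed_le continuous_const (hfa s)).inter
      (isClosed_le (hfa s) continuous_const)
  have hS0 : S 0 ⊆ Icc (v 0) (w 0) := by
    intro a ha
    have := ha 0 (by simp)
    rw [hf a 0 le_rfl] at this
    simpa using this
  obtain ⟨a, ha⟩ := IsCompact.nonempty_iInter_of_sequence_nonempty_isCompact_isClosed S
    (fun j a ha s hs => ha s ⟨hs.1, hs.2.trans (by simp)⟩)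
    (fun j => by
      obtain ⟨a, h₁, h₂⟩ := hexists j (Nat.cast_nonneg j)
      exact ⟨a, fun s hs => hbetween a j h₁ h₂ (Nat.cast_nonneg j) s hs.1 hs.2⟩)
    (isCompact_Icc.of_isClosed_subset (hSclosed 0) hS0) hSclosed
  have hbd : ∀ s ≥ 0, v s ≤ f a s ∧ f a s ≤ w s := by
    intro s hs
    obtain ⟨j, hj⟩ := exists_nat_ge s
    exact mem_iInter.1 ha j s ⟨hs, hj⟩
  obtain ⟨F, hF, hFf, hFeq⟩ := exists_contDiff_of_integral_eq n
    (Q := fun s u => A * (u ^ 3 - (1 - s) * u)) (by unfold Function.uncurry; fun_prop) (hkc a)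
    (hf a) (fun s hs => by
      have h := hbd s hs
      have e : q s (f a s) = f a s := by
        simp only [hq]
        rw [min_eq_left h.2, max_eq_right h.1]
      simp only [hKdef, e])
  exact ⟨F, hF, fun s hs => by rw [hFf s hs]; exact hbd s hs, hFeq⟩

namespace IsHastingsMcLeod

variable {ν ν₁ : ℝ → ℝ}

/-- Strict inequalities that turn shifts of `ν` into sub- and supersolutions. -/
lemma exists_barrier_constants (h : IsHastingsMcLeod ν ν₁) {M : ℝ} (hM : 0 ≤ M) :
    ∃ g > 0, ∃ c > 0, ∀ τ, 0 ≤ τ → τ ≤ 1 → ∀ z,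
      -(z - τ) * (ν z ^ 3 - z * ν z) < c * ν z + g * (3 * ν z ^ 2 - (z - τ)) ∧
      (z + τ) * (ν z ^ 3 - z * ν z) + M * ν₁ z < c * ν z := by
  obtain ⟨B, hB, Y, hY4, hB₁, hB₂, hY, hB₃⟩ := h.bounds
  set g : ℝ := 2 * B + 1 with hg
  have hg0 : 0 < g := by positivity
  set T : ℝ := (Y + 1) * B + M * B + g * Y + 1 with hT
  have hY0 : 0 < Y := by linarith
  have hT0 : 0 < T := by positivity
  have hν := h.pos (-2)
  set c : ℝ := T / ν (-2) + (M * B + (M * B) ^ 2 + 1) with hc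
  have hc0 : 0 < c := by positivity
  have hcT : ∀ z ≥ -2, T ≤ c * ν z := by
    intro z hz
    have h₁ : ν (-2) ≤ ν z := h.mono.monotone hz
    have h₂ : T / ν (-2) ≤ c := by
      rw [hc]
      have : 0 ≤ M * B + (M * B) ^ 2 + 1 := by positivity
      linarith
    rw [div_le_iff₀ hν] at h₂
    nlinarith
  refine ⟨g, hg0, c, hc0, fun τ hτ hτ1 z => ?_⟩
  have hνz := h.pos z
  have hcν : 0 < c * ν z := by positivity
  have hP := abs_le.1 (hB₂ z)
  have hP₁ := hP.1
  have hP₂ := hP.2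
  have hν₁ := h.deriv_nonneg z
  have hMν : M * ν₁ z ≤ M * B := mul_le_mul_of_nonneg_left (hB₁ z) hM
  have hMB : 0 ≤ M * B := by positivity
  set P : ℝ := ν z ^ 3 - z * ν z with hPdef
  rcases le_or_gt Y z with hz | hz
  · have h₁ := (hY z hz).1
    have h₂ := (hY z hz).2
    have hPneg : P ≤ 0 := by
      have e : P = (ν z ^ 2 - z) * ν z := by rw [hPdef]; ring
      rw [e]
      exact mul_nonpos_of_nonpos_of_nonneg (by linarith) hνz.le
    have hcz := hcT z (by linarith)
    constructor
    · have h₃ : g * ((z - τ) / 2) ≤ g * (3 * ν z ^ 2 - (z - τ)) :=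
        mul_le_mul_of_nonneg_left (by linarith) hg0.le
      have h₄ : (z - τ) * -P ≤ (z - τ) * B := mul_le_mul_of_nonneg_left (by linarith) (by linarith)
      have h₅ : (z - τ) * B ≤ g * ((z - τ) / 2) := by
        rw [hg]
        nlinarith
      linarith
    · have h₃ : (z + τ) * P ≤ 0 := mul_nonpos_of_nonneg_of_nonpos (by linarith) hPneg
      have : 0 < (Y + 1) * B + g * Y + 1 := by positivity
      linarith
  constructor
  · rcases le_or_gt (-1) z with hz' | hz'
    · have hcz := hcT z (by linarith)
      have h₁ : -(z - τ) * P ≤ Y * B := by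
        have a₁ : |-(z - τ)| ≤ Y := abs_le.2 ⟨by linarith, by linarith⟩
        calc -(z - τ) * P ≤ |-(z - τ) * P| := le_abs_self _
          _ = |-(z - τ)| * |P| := abs_mul _ _
          _ ≤ Y * B := mul_le_mul a₁ (hB₂ z) (abs_nonneg _) hY0.le
      have h₂ : g * (-Y) ≤ g * (3 * ν z ^ 2 - (z - τ)) :=
        mul_le_mul_of_nonneg_left (by nlinarith [sq_nonneg (ν z)]) hg0.le
      nlinarith
    · have h₁ : -(z - τ) * P ≤ -(z - τ) * B := mul_le_mul_of_nonneg_left hP₂ (by linarith)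
      have h₂ : g * (-(z - τ)) ≤ g * (3 * ν z ^ 2 - (z - τ)) :=
        mul_le_mul_of_nonneg_left (by nlinarith [sq_nonneg (ν z)]) hg0.le
      have h₃ : -(z - τ) * B ≤ g * (-(z - τ)) := by
        rw [hg]
        nlinarith
      linarith
  · rcases le_or_gt (-2) z with hz' | hz'
    · have hcz := hcT z hz'
      have h₁ : (z + τ) * P ≤ (Y + 1) * B := by
        have a₁ : |z + τ| ≤ Y + 1 := abs_le.2 ⟨by linarith, by linarith⟩
        calc (z + τ) * P ≤ |(z + τ) * P| := le_abs_self _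
          _ = |z + τ| * |P| := abs_mul _ _
          _ ≤ (Y + 1) * B := mul_le_mul a₁ (hB₂ z) (abs_nonneg _) (by linarith)
      have : 0 < g * Y := by positivity
      linarith
    · have h₁ : -z * ν z ≤ P := by
        have : 0 < ν z ^ 3 := by positivity
        linarith
      have hzν : 0 ≤ -z * ν z := mul_nonneg (by linarith) hνz.le
      have h₂ : -(z / 2) * (-z * ν z) ≤ -(z + τ) * P :=
        mul_le_mul (by linarith) h₁ hzν (by linarith)
      have h₃ : M * ν₁ z ≤ M * (B * (1 - z) * ν z) :=
        mul_le_mul_of_nonneg_left (hB₃ z (by linarith)) hM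
      have h₄ : M * B * (1 - z) - z ^ 2 / 2 < c := by
        have : 0 ≤ T / ν (-2) := by positivity
        nlinarith [sq_nonneg (z + M * B)]
      have h₅ : (M * B * (1 - z) - z ^ 2 / 2) * ν z < c * ν z := mul_lt_mul_of_pos_right h₄ hνz
      linarith

lemma sub_le_mul (h : IsHastingsMcLeod ν ν₁) {B : ℝ} (hB : ∀ y, ν₁ y ≤ B) {a b : ℝ} (hab : a < b) :
    ν b - ν a ≤ B * (b - a) := by
  obtain ⟨x, -, e⟩ := h.slope hab
  rw [e]
  exact mul_le_mul_of_nonneg_right (hB x) (by linarith)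

lemma hasDerivAt_profile (h : IsHastingsMcLeod ν ν₁) (e b p s : ℝ) :
    HasDerivAt (fun s => e * (ν ((1 - s) / e ^ 2 + b) + p)) (-e / e ^ 2 * ν₁ ((1 - s) / e ^ 2 + b)) s ∧
    HasDerivAt (fun s => -e / e ^ 2 * ν₁ ((1 - s) / e ^ 2 + b)) (e / (e ^ 2) ^ 2 *
      ((ν ((1 - s) / e ^ 2 + b) ^ 3 - ((1 - s) / e ^ 2 + b) * ν ((1 - s) / e ^ 2 + b)) / 4)) s := by
  have e₁ : HasDerivAt (fun s : ℝ => (1 - s) / e ^ 2 + b) (-1 / e ^ 2) s := by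
    simpa using (((hasDerivAt_id s).const_sub 1).div_const (e ^ 2)).add_const b
  constructor
  · refine ((((h.deriv₁ _).comp s e₁).add_const p).const_mul e).congr_deriv ?_
    ring
  · refine (((h.deriv₂ _).comp s e₁).const_mul (-e / e ^ 2)).congr_deriv ?_
    ring

/-- The radial profile of the ground state, in the variable `s = |x|²` and dimension `n + 1`. -/
lemma exists_radial_profile (h : IsHastingsMcLeod ν ν₁) (n : ℕ) :
    ∃ δ₀ > 0, ∃ C > 0, ∀ e : ℝ, 0 < e → e ^ 2 < δ₀ → ∃ F : ℝ → ℝ, ContDiff ℝ 2 F ∧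
      (∀ s ≥ 0, 0 < F s ∧ |F s - e * ν ((1 - s) / e ^ 2)| ≤ C * e ^ 3) ∧
      ∀ s ≥ 0, 4 * s * deriv (deriv F) s + 2 * (n + 1) * deriv F s =
        (e ^ 6)⁻¹ * (F s ^ 3 - (1 - s) * F s) := by
  obtain ⟨g, hg, c, hc, hbar⟩ := h.exists_barrier_constants (M := 2 * (n + 1)) (by positivity)
  obtain ⟨B, hB, hB₁⟩ := h.deriv_bdd
  refine ⟨1 / c, by positivity, c * B + g, by positivity, fun e he hδ => ?_⟩
  have hδ0 : 0 < e ^ 2 := by positivity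
  rw [lt_div_iff₀ hc] at hδ
  have hτ0 : 0 < c * e ^ 2 := by positivity
  have hνc := h.continuous
  have key : ∀ b p s : ℝ, 4 * s * (e / (e ^ 2) ^ 2 *
      ((ν ((1 - s) / e ^ 2 + b) ^ 3 - ((1 - s) / e ^ 2 + b) * ν ((1 - s) / e ^ 2 + b)) / 4)) +
      2 * (n + 1) * (-e / e ^ 2 * ν₁ ((1 - s) / e ^ 2 + b)) -
      (e ^ 6)⁻¹ * ((e * (ν ((1 - s) / e ^ 2 + b) + p)) ^ 3 -
        (1 - s) * (e * (ν ((1 - s) / e ^ 2 + b) + p))) =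
      (e ^ 3)⁻¹ * ((1 - e ^ 2 * ((1 - s) / e ^ 2)) *
        (ν ((1 - s) / e ^ 2 + b) ^ 3 - ((1 - s) / e ^ 2 + b) * ν ((1 - s) / e ^ 2 + b)) -
        2 * (n + 1) * e ^ 2 * ν₁ ((1 - s) / e ^ 2 + b) - ((ν ((1 - s) / e ^ 2 + b) + p) ^ 3 -
          (1 - s) / e ^ 2 * (ν ((1 - s) / e ^ 2 + b) + p))) := by
    intro b p s
    generalize ν ((1 - s) / e ^ 2 + b) = N
    generalize ν₁ ((1 - s) / e ^ 2 + b) = N₁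
    field_simp
    ring
  refine (exists_solution_between n (A := (e ^ 6)⁻¹)
    (W := e * (ν (1 / e ^ 2 + c * e ^ 2) + e ^ 2 * g)) (by positivity)
    (fun s => (h.hasDerivAt_profile e (-(c * e ^ 2)) 0 s).1)
    (fun s => (h.hasDerivAt_profile e (-(c * e ^ 2)) 0 s).2) (by fun_prop)
    (fun s => (h.hasDerivAt_profile e (c * e ^ 2) (e ^ 2 * g) s).1)
    (fun s => (h.hasDerivAt_profile e (c * e ^ 2) (e ^ 2 * g) s).2) (by fun_prop)
    (fun s => mul_pos he (by linarith [h.pos ((1 - s) / e ^ 2 + -(c * e ^ 2))])) (fun s => ?_)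
    (fun s hs => ?_) (fun s hs => ?_) (fun s hs => ?_)).imp ?_
  · refine mul_lt_mul_of_pos_left ?_ he
    have h₁ : ν ((1 - s) / e ^ 2 + -(c * e ^ 2)) < ν ((1 - s) / e ^ 2 + c * e ^ 2) :=
      h.mono (by linarith)
    have h₂ : 0 < e ^ 2 * g := by positivity
    linarith
  · have h₁ : ν ((1 - s) / e ^ 2 + c * e ^ 2) ≤ ν (1 / e ^ 2 + c * e ^ 2) := by
      have h₂ : (1 - s) / e ^ 2 ≤ 1 / e ^ 2 :=
        div_le_div_of_nonneg_right (by linarith) hδ0.le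
      exact h.mono.monotone (by linarith)
    exact mul_le_mul_of_nonneg_left (by linarith) he.le
  · have hk := key (-(c * e ^ 2)) 0 s
    have hb := (hbar (c * e ^ 2) hτ0.le (by linarith) ((1 - s) / e ^ 2 + -(c * e ^ 2))).2
    rw [← sub_pos, hk]
    refine mul_pos (by positivity) ?_
    generalize ν ((1 - s) / e ^ 2 + -(c * e ^ 2)) = N at hb ⊢
    generalize ν₁ ((1 - s) / e ^ 2 + -(c * e ^ 2)) = N₁ at hb ⊢
    generalize (1 - s) / e ^ 2 = y at hb ⊢
    have := mul_lt_mul_of_pos_left hb hδ0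
    linarith
  · have hk := key (c * e ^ 2) (e ^ 2 * g) s
    have hb := (hbar (c * e ^ 2) hτ0.le (by linarith) ((1 - s) / e ^ 2 + c * e ^ 2)).1
    rw [← sub_neg, hk]
    refine mul_neg_of_pos_of_neg (by positivity) ?_
    have hN := h.pos ((1 - s) / e ^ 2 + c * e ^ 2)
    have hN₁ := h.deriv_nonneg ((1 - s) / e ^ 2 + c * e ^ 2)
    generalize ν ((1 - s) / e ^ 2 + c * e ^ 2) = N at hb hN ⊢
    generalize ν₁ ((1 - s) / e ^ 2 + c * e ^ 2) = N₁ at hb hN₁ ⊢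
    generalize (1 - s) / e ^ 2 = y at hb ⊢
    have h₁ := mul_lt_mul_of_pos_left hb hδ0
    have h₂ : 0 ≤ 2 * (n + 1) * e ^ 2 * N₁ := by positivity
    have h₃ : 0 < 3 * N * (e ^ 2 * g) ^ 2 + (e ^ 2 * g) ^ 3 := by positivity
    linarith
  · rintro F ⟨hF, hFb, hFeq⟩
    refine ⟨hF, fun s hs => ⟨?_, ?_⟩, hFeq⟩
    · refine lt_of_lt_of_le ?_ (hFb s hs).1
      exact mul_pos he (by linarith [h.pos ((1 - s) / e ^ 2 + -(c * e ^ 2))])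
    · obtain ⟨h₁, h₂⟩ := hFb s hs
      have h₃ := h.sub_le_mul hB₁ (show (1 - s) / e ^ 2 < (1 - s) / e ^ 2 + c * e ^ 2 by linarith)
      have h₄ := h.sub_le_mul hB₁ (show (1 - s) / e ^ 2 + -(c * e ^ 2) < (1 - s) / e ^ 2 by linarith)
      have h₅ := mul_le_mul_of_nonneg_left h₃ he.le
      have h₆ := mul_le_mul_of_nonneg_left h₄ he.le
      have h₇ : 0 < g * e ^ 3 := by positivity
      rw [abs_le]
      constructor <;> nlinarith

end IsHastingsMcLeod

/-- The Laplacian of a radial function written in the variable `s = |x|²`. -/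
lemma lap_comp_norm_sq {d : ℕ} {F : ℝ → ℝ} (hF : ContDiff ℝ 2 F) (x : EuclideanSpace ℝ (Fin d)) :
    lap (fun y => F (‖y‖ ^ 2)) x =
      4 * ‖x‖ ^ 2 * deriv (deriv F) (‖x‖ ^ 2) + 2 * d * deriv F (‖x‖ ^ 2) := by
  have hF' : ContDiff ℝ 1 (deriv F) := by
    rw [show (2 : WithTop ℕ∞) = 1 + 1 by norm_num, contDiff_succ_iff_deriv] at hF
    exact hF.2.2
  have hcomp : ∀ G : ℝ → ℝ, ContDiff ℝ 1 G → ∀ y : EuclideanSpace ℝ (Fin d),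
      HasFDerivAt (fun y : EuclideanSpace ℝ (Fin d) => G (‖y‖ ^ 2))
        (deriv G (‖y‖ ^ 2) • (2 • innerSL ℝ y)) y := by
    intro G hG y
    exact ((hG.differentiable (by norm_num)) _).hasDerivAt.comp_hasFDerivAt y
      (hasStrictFDerivAt_norm_sq y).hasFDerivAt
  have hinner : ∀ (y : EuclideanSpace ℝ (Fin d)) i,
      inner ℝ y (EuclideanSpace.single i (1:ℝ)) = y i := by
    intro y i
    simp [EuclideanSpace.inner_single_right]
  have h₁ : ∀ i, (fun y => fderiv ℝ (fun y : EuclideanSpace ℝ (Fin d) => F (‖y‖ ^ 2)) y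
      (EuclideanSpace.single i 1)) = fun y => deriv F (‖y‖ ^ 2) * (2 * y i) := by
    intro i
    ext y
    rw [(hcomp F (hF.of_le (by norm_num)) y).fderiv]
    simp [hinner]
  unfold lap
  have h₂ : ∀ i : Fin d, fderiv ℝ (fun y => fderiv ℝ (fun y : EuclideanSpace ℝ (Fin d) => F (‖y‖ ^ 2)) y
      (EuclideanSpace.single i 1)) x (EuclideanSpace.single i 1) =
      4 * deriv (deriv F) (‖x‖ ^ 2) * x i ^ 2 + 2 * deriv F (‖x‖ ^ 2) := by
    intro i
    rw [h₁ i]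
    have hc : HasFDerivAt (fun y : EuclideanSpace ℝ (Fin d) => 2 * y i)
        ((2:ℝ) • (EuclideanSpace.proj i : EuclideanSpace ℝ (Fin d) →L[ℝ] ℝ)) x :=
      (EuclideanSpace.proj (𝕜 := ℝ) i).hasFDerivAt.const_mul (2:ℝ)
    have hm : HasFDerivAt (fun y : EuclideanSpace ℝ (Fin d) => deriv F (‖y‖ ^ 2) * (2 * y i)) _ x :=
      (hcomp (deriv F) hF' x).mul hc
    rw [hm.fderiv]
    simp [hinner]
    ring
  simp only [h₂]
  rw [Finset.sum_add_distrib, ← Finset.mul_sum, ← EuclideanSpace.real_norm_sq_eq]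
  simp
  ring

/-- Uniform Painlevé approximation of the Thomas–Fermi ground state: for
small `ε` there is a positive classical solution `η_ε` of the stationary Gross–Pitaevskii
equation with `sup_x |η_ε(x) − ε^{1/3} ν₀((1−|x|²)/ε^{2/3})| ≤ C ε^{(4−d)/3}`. -/
theorem ground_state_uniform_painleve_approximation
    (d : ℕ) (hd : d = 1 ∨ d = 2 ∨ d = 3)
    (ν₀ : ℝ → ℝ)
    (hsmooth : ContDiff ℝ (⊤ : ℕ∞) ν₀)
    (hpos : ∀ y : ℝ, 0 < ν₀ y)
    (hmono : StrictMono ν₀)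
    (hode : ∀ y : ℝ, 4 * deriv (deriv ν₀) y + y * ν₀ y - (ν₀ y) ^ 3 = 0)
    (htop : Tendsto (fun y : ℝ => ν₀ y / Real.sqrt y) atTop (nhds 1))
    (hbot : Tendsto ν₀ atBot (nhds 0)) :
    ∃ ε₀ > (0:ℝ), ∃ C > (0:ℝ), ∀ ε : ℝ, 0 < ε → ε < ε₀ →
      ∃ η : EuclideanSpace ℝ (Fin d) → ℝ,
        ContDiff ℝ 2 η ∧
        (∀ x : EuclideanSpace ℝ (Fin d),
          ε ^ 2 * lap η x + (1 - ‖x‖ ^ 2) * η x - (η x) ^ 3 = 0) ∧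
        (∀ x : EuclideanSpace ℝ (Fin d), 0 < η x) ∧
        (∀ x : EuclideanSpace ℝ (Fin d),
          |η x - ε ^ ((1:ℝ)/3) * ν₀ ((1 - ‖x‖ ^ 2) / ε ^ ((2:ℝ)/3))|
            ≤ C * ε ^ (((4:ℝ) - d)/3)) := by
  have hdiff : ContDiff ℝ 1 (deriv ν₀) := by
    have h₂ : ContDiff ℝ (1 + 1) ν₀ := contDiff_infty.1 hsmooth 2
    rw [contDiff_succ_iff_deriv] at h₂
    exact h₂.2.2
  have h : IsHastingsMcLeod ν₀ (deriv ν₀) :=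
    { pos := hpos
      mono := hmono
      deriv₁ := fun y => ((hsmooth.differentiable (by simp)) y).hasDerivAt
      deriv₂ := fun y => ((hdiff.differentiable (by norm_num)) y).hasDerivAt.congr_deriv
        (by linarith [hode y])
      top := htop }
  obtain ⟨n, rfl⟩ : ∃ n, d = n + 1 := ⟨d - 1, by omega⟩
  obtain ⟨δ₀, hδ₀, C, hC, hF⟩ := h.exists_radial_profile n
  refine ⟨min 1 (δ₀ ^ ((3:ℝ) / 2)), by positivity, C, hC, fun ε hε hε₀ => ?_⟩
  obtain ⟨hε₁, hε₂⟩ := lt_min_iff.1 hε₀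
  have hpow : ∀ k : ℕ, (ε ^ ((1:ℝ) / 3)) ^ k = ε ^ ((k:ℝ) / 3) := fun k => by
    rw [← rpow_natCast, ← rpow_mul hε.le]
    ring_nf
  have he₂ : (ε ^ ((1:ℝ) / 3)) ^ 2 = ε ^ ((2:ℝ) / 3) := mod_cast hpow 2
  have he₃ : (ε ^ ((1:ℝ) / 3)) ^ 3 = ε := by
    rw [hpow]
    norm_num
  have he₆ : (ε ^ ((1:ℝ) / 3)) ^ 6 = ε ^ 2 := by
    rw [show 6 = 3 * 2 by norm_num, pow_mul, he₃]
  have hδ : (ε ^ ((1:ℝ) / 3)) ^ 2 < δ₀ := by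
    rw [he₂]
    calc ε ^ ((2:ℝ) / 3) < (δ₀ ^ ((3:ℝ) / 2)) ^ ((2:ℝ) / 3) :=
          rpow_lt_rpow hε.le hε₂ (by norm_num)
      _ = δ₀ := by
          rw [← rpow_mul hδ₀.le]
          norm_num
  obtain ⟨F, hF₂, hFb, hFeq⟩ := hF _ (by positivity) hδ
  rw [he₂, he₃] at hFb
  rw [he₆] at hFeq
  refine ⟨fun x => F (‖x‖ ^ 2), hF₂.comp (contDiff_norm_sq ℝ), fun x => ?_,
    fun x => (hFb _ (by positivity)).1, fun x => ?_⟩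
  · rw [lap_comp_norm_sq hF₂ x]
    push_cast
    rw [hFeq _ (by positivity), mul_inv_cancel_left₀ (by positivity)]
    ring
  · refine (hFb _ (by positivity)).2.trans (mul_le_mul_of_nonneg_left ?_ hC.le)
    calc ε = ε ^ (1:ℝ) := (rpow_one ε).symm
      _ ≤ ε ^ (((4:ℝ) - (n + 1 : ℕ)) / 3) := by
          refine rpow_le_rpow_of_exponent_ge hε hε₁.le ?_
          push_cast
          linarith [(n.cast_nonneg : (0:ℝ) ≤ n)]
end

section
/- Let d ≥ 1 be an integer and ε > 0. Let η ∈ C²(ℝ^d) be radially symmetric, satisfy ε²Δη(x) + (1−|x|²)η(x) − η(x)³ = 0 for all x ∈ ℝ^d, satisfy η(x) > 0 whenever |x| ≤ (1+ε^{2/3})^{1/2}, and satisfy η(x) → 0 as |x| → ∞. Then η(x) > 0 for every x ∈ ℝ^d. -/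
open Filter Real

open Filter Topology in
/-- Second-order necessary condition for a local minimum on the line. -/
theorem second_deriv_nonneg_of_isLocalMin {f f' : ℝ → ℝ} {a x : ℝ}
    (hf : ∀ t, HasDerivAt f (f' t) t) (hf' : HasDerivAt f' a x) (hmin : IsLocalMin f x) :
    0 ≤ a := by
  by_contra! ha
  have hd : deriv f = f' := funext fun t => (hf t).deriv
  have hmax : IsLocalMax f x := by
    apply isLocalMax_of_deriv_deriv_neg
    · rwa [hd, hf'.deriv]
    · exact hmin.deriv_eq_zero
    · exact (hf x).continuousAt
  have hconst : f =ᶠ[𝓝 x] fun _ => f x := by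
    filter_upwards [hmin, hmax] with t h₁ h₂ using le_antisymm h₂ h₁
  have hzero : f' =ᶠ[𝓝 x] fun _ => (0 : ℝ) := by
    have := hconst.deriv
    rw [hd] at this
    simpa using this
  have := hf'.unique ((hasDerivAt_const x (0 : ℝ)).congr_of_eventuallyEq hzero)
  exact ha.ne this

/-- At a local minimum of the difference of a `C²` function and a Gaussian, the Laplacian of the
function is at least that of the Gaussian. -/
theorem gaussian_laplacian_le_lap_of_isLocalMin {d : ℕ} {u : EuclideanSpace ℝ (Fin d) → ℝ}
    (hu : ContDiff ℝ 2 u) (δ α : ℝ) {x : EuclideanSpace ℝ (Fin d)}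
    (hmin : IsLocalMin (fun y => u y - δ * Real.exp (-α * ‖y‖ ^ 2)) x) :
    (4 * α ^ 2 * ‖x‖ ^ 2 - 2 * α * d) * (δ * Real.exp (-α * ‖x‖ ^ 2)) ≤ lap u x := by
  have hsum : (4 * α ^ 2 * ‖x‖ ^ 2 - 2 * α * d) * (δ * Real.exp (-α * ‖x‖ ^ 2)) =
      ∑ i : Fin d, (4 * α ^ 2 * x i ^ 2 - 2 * α) * (δ * Real.exp (-α * ‖x‖ ^ 2)) := by
    rw [← Finset.sum_mul, Finset.sum_sub_distrib, ← Finset.mul_sum, EuclideanSpace.real_norm_sq_eq]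
    simp
    ring_nf
    simp
  rw [hsum, lap]
  refine Finset.sum_le_sum fun i _ => ?_
  set e : EuclideanSpace ℝ (Fin d) := EuclideanSpace.single i 1 with he
  have hline (t : ℝ) : HasDerivAt (fun s : ℝ => x + s • e) e t := by
    simpa using ((hasDerivAt_id t).smul_const e).const_add x
  have hnorm (t : ℝ) : ‖x + t • e‖ ^ 2 = ‖x‖ ^ 2 + 2 * t * x i + t ^ 2 := by
    rw [norm_add_sq_real, inner_smul_right, norm_smul, he, EuclideanSpace.inner_single_right]
    simp
    ring
  have hquad (t : ℝ) : HasDerivAt (fun s : ℝ => -α * (‖x‖ ^ 2 + 2 * s * x i + s ^ 2))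
      (-α * (2 * x i + 2 * t)) t := by
    refine HasDerivAt.const_mul _ ?_
    have h := ((((hasDerivAt_id t).const_mul 2).mul_const (x i)).const_add (‖x‖ ^ 2)).add
      (hasDerivAt_pow 2 t)
    simp only [id_eq, mul_one, Nat.cast_ofNat, Nat.add_one_sub_one, pow_one] at h
    exact h
  have hdu : Differentiable ℝ (fun y => fderiv ℝ u y e) :=
    ((hu.fderiv_right (m := 1) (by norm_num)).clm_apply contDiff_const).differentiable (by norm_num)
  have h₁ (t : ℝ) : HasDerivAt
      (fun s : ℝ => u (x + s • e) - δ * Real.exp (-α * (‖x‖ ^ 2 + 2 * s * x i + s ^ 2)))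
      (fderiv ℝ u (x + t • e) e - δ * (Real.exp (-α * (‖x‖ ^ 2 + 2 * t * x i + t ^ 2)) *
        (-α * (2 * x i + 2 * t)))) t :=
    (((hu.differentiable (by norm_num) _).hasFDerivAt.comp_hasDerivAt t (hline t))).sub
      ((hquad t).exp.const_mul δ)
  have hlin : HasDerivAt (fun s : ℝ => -α * (2 * x i + 2 * s)) (-α * 2) 0 := by
    simpa using (((hasDerivAt_id (0 : ℝ)).const_mul 2).const_add (2 * x i)).const_mul (-α)
  have h₂ := ((hdu (x + (0 : ℝ) • e)).hasFDerivAt.comp_hasDerivAt 0 (hline 0)).sub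
      (((hquad 0).exp.mul hlin).const_mul δ)
  have hmin' : IsLocalMin
      (fun s : ℝ => u (x + s • e) - δ * Real.exp (-α * (‖x‖ ^ 2 + 2 * s * x i + s ^ 2))) 0 := by
    have hc : Filter.Tendsto (fun s : ℝ => x + s • e) (nhds 0) (nhds x) := by
      simpa using (hline 0).continuousAt.tendsto
    have h := hc.eventually hmin
    filter_upwards [h] with s hs
    simpa [hnorm] using hs
  have h := second_deriv_nonneg_of_isLocalMin h₁ h₂ hmin'
  simp only [zero_smul, add_zero, mul_zero, zero_mul, ne_eq, OfNat.ofNat_ne_zero,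
    not_false_eq_true, zero_pow] at h
  linarith

open Filter Topology in
/-- A continuous function vanishing at infinity which is negative somewhere attains a
global minimum, and this minimum is negative. -/
theorem exists_negative_global_min {E : Type*} [TopologicalSpace E] {v : E → ℝ}
    (hv : Continuous v) (hlim : Tendsto v (cocompact E) (𝓝 0)) {x : E} (hx : v x < 0) :
    ∃ z, v z < 0 ∧ ∀ y, v z ≤ v y := by
  obtain ⟨z, hz⟩ := hv.exists_forall_le' x ((hlim.eventually (eventually_gt_nhds hx)).mono fun _ h => h.le)
  exact ⟨z, (hz x).trans_lt hx, hz⟩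

/-- The nonlinear comparison at an outer point: `q` stands for `|x|²`, `a` for the value of the
solution and `w` for the value of the barrier. -/
theorem not_lt_of_supersolution {q a w : ℝ} (hq : 1 < q) (hw : 0 < w) (hw1 : w ≤ 1)
    (h : 2 * q * w ≤ (q - 1 + a ^ 2) * a) : ¬ a < w := by
  intro haw
  have hc : 0 < q - 1 + a ^ 2 := by linarith [sq_nonneg a]
  have hpos : 0 < 2 * q * w := by positivity
  have ha : 0 < a := pos_of_mul_pos_right (hpos.trans_le h) hc.le
  have ha1 : a ^ 2 ≤ 1 := pow_le_one₀ ha.le (by linarith)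
  have : (q - 1 + a ^ 2) * a ≤ q * w := by
    gcongr
    linarith
  linarith

/-- If `α ≥ max d (1 / ε)`, then `exp (-α |x|²)` is a strict subsolution for `|x| > 1`. -/
theorem two_mul_le_barrier_coefficient {d α ε q : ℝ} (hα : 0 < α) (hdα : d ≤ α)
    (hαε : 1 ≤ α * ε) (hq : 1 < q) :
    2 * q ≤ ε ^ 2 * (4 * α ^ 2 * q - 2 * α * d) := by
  have h₀ : α * d ≤ α * α := by gcongr
  have h₁ : 2 * α ^ 2 * q ≤ 4 * α ^ 2 * q - 2 * α * d := by
    nlinarith [mul_nonneg (sq_nonneg α) (sub_nonneg.2 hq.le)]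
  have h₂ : 1 ≤ (α * ε) ^ 2 := one_le_pow₀ hαε
  calc 2 * q ≤ 2 * q * (α * ε) ^ 2 := le_mul_of_one_le_right (by linarith) h₂
    _ = ε ^ 2 * (2 * α ^ 2 * q) := by ring
    _ ≤ _ := by gcongr

/-- A radially symmetric classical solution of the stationary
Gross–Pitaevskii equation which is positive on the ball `|x| ≤ (1+ε^{2/3})^{1/2}` and decays
to `0` at infinity is positive everywhere. -/
theorem positivity_propagates
    (d : ℕ) (hd : 1 ≤ d) (ε : ℝ) (hε : 0 < ε)
    (η : EuclideanSpace ℝ (Fin d) → ℝ)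
    (hC2 : ContDiff ℝ 2 η)
    (hradial : ∀ x y : EuclideanSpace ℝ (Fin d), ‖x‖ = ‖y‖ → η x = η y)
    (heq : ∀ x : EuclideanSpace ℝ (Fin d),
      ε ^ 2 * lap η x + (1 - ‖x‖ ^ 2) * η x - (η x) ^ 3 = 0)
    (hposball : ∀ x : EuclideanSpace ℝ (Fin d),
      ‖x‖ ≤ Real.sqrt (1 + ε ^ ((2:ℝ)/3)) → 0 < η x)
    (hdecay : Filter.Tendsto η (Filter.cocompact (EuclideanSpace ℝ (Fin d))) (nhds 0)) :
    ∀ x : EuclideanSpace ℝ (Fin d), 0 < η x := by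
  have hε3 : 0 < ε ^ ((2 : ℝ) / 3) := Real.rpow_pos_of_pos hε _
  set R := Real.sqrt (1 + ε ^ ((2 : ℝ) / 3)) with hR
  have hR1 : 1 < R := by
    rw [hR, Real.lt_sqrt (by norm_num)]
    linarith
  obtain ⟨x₀, hx₀, hx₀min⟩ := (isCompact_closedBall (0 : EuclideanSpace ℝ (Fin d)) R).exists_isMinOn
    ⟨0, by simp; linarith⟩ hC2.continuous.continuousOn
  have hη₀ : 0 < η x₀ := hposball x₀ (by simpa using hx₀)
  set δ := min 1 (η x₀) with hδdef
  have hδ : 0 < δ := lt_min one_pos hη₀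
  set α : ℝ := d + 1 / ε with hαdef
  have hdpos : (0 : ℝ) ≤ d := Nat.cast_nonneg d
  have hinv : 0 < 1 / ε := by positivity
  have hα : 0 < α := by positivity
  have hexp (y : EuclideanSpace ℝ (Fin d)) : Real.exp (-α * ‖y‖ ^ 2) ≤ 1 := by
    rw [Real.exp_le_one_iff]
    nlinarith [sq_nonneg ‖y‖]
  have hαε : 1 ≤ α * ε := by
    have : α * ε = d * ε + 1 := by rw [hαdef]; field_simp
    nlinarith
  have hdα : (d : ℝ) ≤ α := by linarith
  suffices h : ∀ x, 0 ≤ η x - δ * Real.exp (-α * ‖x‖ ^ 2) by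
    intro x
    have : 0 < δ * Real.exp (-α * ‖x‖ ^ 2) := by positivity
    linarith [h x]
  by_contra! hneg
  obtain ⟨x, hx⟩ := hneg
  have hgauss : Tendsto (fun y : EuclideanSpace ℝ (Fin d) => Real.exp (-α * ‖y‖ ^ 2))
      (cocompact _) (nhds 0) := by
    refine Real.tendsto_exp_atBot.comp (Tendsto.const_mul_atTop_of_neg (by linarith) ?_)
    exact (tendsto_pow_atTop two_ne_zero).comp tendsto_norm_cocompact_atTop
  have hlim : Tendsto (fun y => η y - δ * Real.exp (-α * ‖y‖ ^ 2)) (cocompact _) (nhds 0) := by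
    simpa using hdecay.sub (hgauss.const_mul δ)
  have hcont : Continuous (fun y => η y - δ * Real.exp (-α * ‖y‖ ^ 2)) := by
    have := hC2.continuous
    fun_prop
  obtain ⟨z, hz, hzmin⟩ := exists_negative_global_min hcont hlim hx
  have hzR : R < ‖z‖ := by
    by_contra! hle
    have h₁ : η x₀ ≤ η z := hx₀min (by simpa using hle)
    have h₂ : δ ≤ η x₀ := min_le_right _ _
    nlinarith [hexp z]
  have hlap := gaussian_laplacian_le_lap_of_isLocalMin hC2 δ α (Eventually.of_forall hzmin)
  set w := δ * Real.exp (-α * ‖z‖ ^ 2) with hw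
  have hwpos : 0 < w := by positivity
  have hw1 : w ≤ 1 := by
    have : δ ≤ 1 := min_le_left _ _
    nlinarith [hexp z, Real.exp_pos (-α * ‖z‖ ^ 2)]
  have hz1 : 1 < ‖z‖ ^ 2 := by nlinarith
  have hcoef : 2 * ‖z‖ ^ 2 ≤ ε ^ 2 * (4 * α ^ 2 * ‖z‖ ^ 2 - 2 * α * d) :=
    two_mul_le_barrier_coefficient hα hdα hαε hz1
  have hlow : 2 * ‖z‖ ^ 2 * w ≤ ε ^ 2 * lap η z := by
    calc 2 * ‖z‖ ^ 2 * w ≤ ε ^ 2 * (4 * α ^ 2 * ‖z‖ ^ 2 - 2 * α * d) * w := by gcongr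
      _ = ε ^ 2 * ((4 * α ^ 2 * ‖z‖ ^ 2 - 2 * α * d) * w) := by ring
      _ ≤ ε ^ 2 * lap η z := by gcongr
  have hpde : ε ^ 2 * lap η z = (‖z‖ ^ 2 - 1 + η z ^ 2) * η z := by linear_combination heq z
  rw [hpde] at hlow
  exact not_lt_of_supersolution hz1 hwpos hw1 hlow (by linarith)
end

section
/- Let ν ∈ C²(ℝ) be strictly positive and strictly increasing with 4ν''(y) + yν(y) − ν(y)³ = 0 on ℝ, and let y₀ > 0 satisfy ν(y₀)² = y₀ and ν(y)² > y for all y < y₀. Then ν'(y₀) ≤ (9/32)^{1/3} √y₀. -/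
open Real

theorem monotoneOn_Iic_of_hasDerivAt_nonneg {f f' : ℝ → ℝ} {a : ℝ}
    (hf : ∀ y, HasDerivAt f (f' y) y) (hf' : ∀ y < a, 0 ≤ f' y) : MonotoneOn f (Set.Iic a) := by
  refine monotoneOn_of_deriv_nonneg (convex_Iic a)
    (fun y _ => (hf y).continuousAt.continuousWithinAt)
    (fun y _ => (hf y).differentiableAt.differentiableWithinAt) fun y hy => ?_
  rw [interior_Iic] at hy
  rw [(hf y).deriv]
  exact hf' y hy

/-- A function whose derivative is bounded below by a positive constant on a left half-line is
negative somewhere on it. -/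
theorem exists_le_neg_of_hasDerivAt_ge {f f' : ℝ → ℝ} {a ε : ℝ} (hε : 0 < ε)
    (hf : ∀ y, HasDerivAt f (f' y) y) (hf' : ∀ y ≤ a, ε ≤ f' y) : ∃ y ≤ a, f y < 0 := by
  have hmono : MonotoneOn (fun y => f y - ε * y) (Set.Iic a) :=
    monotoneOn_Iic_of_hasDerivAt_nonneg
      (fun y => (hf y).sub ((hasDerivAt_id y).const_mul ε))
      fun y hy => by linarith [hf' y hy.le]
  have hle : a - (|f a| / ε + 1) ≤ a := by
    have : 0 ≤ |f a| / ε := by positivity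
    linarith
  refine ⟨a - (|f a| / ε + 1), hle, ?_⟩
  have h := hmono (Set.mem_Iic.2 hle) Set.self_mem_Iic hle
  have hmul : ε * (|f a| / ε) = |f a| := mul_div_cancel₀ _ hε.ne'
  simp only [mul_sub, mul_add, hmul] at h
  linarith [le_abs_self (f a)]

/-- A function that is positive to the left of one of its zeros has nonpositive derivative there. -/
theorem HasDerivAt.nonpos_of_pos_left {f : ℝ → ℝ} {f' a : ℝ} (hf : HasDerivAt f f' a)
    (ha : f a = 0) (hpos : ∀ y < a, 0 < f y) : f' ≤ 0 := by
  have hslope := (hasDerivAt_iff_tendsto_slope_left_right.1 hf).1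
  refine le_of_tendsto hslope ?_
  filter_upwards [self_mem_nhdsWithin] with y hy
  have hy : y < a := hy
  rw [slope_def_field, ha]
  exact div_nonpos_of_nonneg_of_nonpos (by linarith [hpos y hy]) (by linarith)

section PainleveII

variable {ν N : ℝ → ℝ} {y₀ : ℝ}

/-- Left of the inflection point, a positive increasing Painlevé-II solution is log-concave. -/
theorem painleveII_logConcave (hν : ∀ y, HasDerivAt ν (N y) y)
    (hN : ∀ y, HasDerivAt N ((ν y ^ 3 - y * ν y) / 4) y)
    (hpos : ∀ y, 0 < ν y) (hmono : Monotone ν) (hN0 : ∀ y, 0 ≤ N y)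
    (hfix : ν y₀ ^ 2 = y₀) (habove : ∀ y < y₀, y < ν y ^ 2) :
    ∀ y ≤ y₀, ν y ^ 2 * (ν y ^ 2 - y) / 4 ≤ N y ^ 2 := by
  have hNmono : MonotoneOn N (Set.Iic y₀) :=
    monotoneOn_Iic_of_hasDerivAt_nonneg hN fun y hy => by
      nlinarith [mul_pos (hpos y) (sub_pos.2 (habove y hy))]
  have hslope : 2 * ν y₀ * N y₀ ≤ 1 := by
    have h := HasDerivAt.nonpos_of_pos_left (((hν y₀).pow 2).sub (hasDerivAt_id y₀))
      (by simp [hfix]) (fun y hy => by simpa using habove y hy)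
    norm_num at h
    linarith
  have hslope' : ∀ y ≤ y₀, 2 * ν y * N y ≤ 1 := fun y hy => by
    have := mul_le_mul (hmono hy) (hNmono hy Set.self_mem_Iic hy) (hN0 y) (hpos y₀).le
    linarith
  have hD : ∀ y, HasDerivAt (fun y => N y ^ 2 - ν y ^ 2 * (ν y ^ 2 - y) / 4)
      (ν y ^ 2 * (1 - 2 * ν y * N y) / 4) y := fun y => by
    refine (((hN y).pow 2).sub ((((hν y).pow 2).mul
      (((hν y).pow 2).sub (hasDerivAt_id y))).div_const 4)).congr_deriv ?_
    simp
    ring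
  have hDmono := monotoneOn_Iic_of_hasDerivAt_nonneg (a := y₀) hD fun y hy => by
    have := hslope' y hy.le
    have : 0 ≤ 1 - 2 * ν y * N y := by linarith
    positivity
  intro a ha
  by_contra! hlt
  set d := ν a ^ 2 * (ν a ^ 2 - a) / 4 - N a ^ 2 with hd
  have hdpos : 0 < d := by linarith
  -- a negative defect would bound `ν''` below by a positive constant near `-∞`
  have hνa := hpos a
  have key : ∀ y ≤ a, d / ν a ≤ (ν y ^ 3 - y * ν y) / 4 := fun y hy => by
    have h := hDmono (Set.mem_Iic.2 (hy.trans ha)) (Set.mem_Iic.2 ha) hy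
    have h1 : d ≤ ν y * ((ν y ^ 3 - y * ν y) / 4) := by
      simp only at h
      nlinarith [sq_nonneg (N y)]
    have h2 : 0 ≤ (ν y ^ 3 - y * ν y) / 4 := by
      by_contra! hneg
      nlinarith [hpos y]
    rw [div_le_iff₀ hνa]
    nlinarith [hmono hy]
  obtain ⟨y, -, hNy⟩ := exists_le_neg_of_hasDerivAt_ge (div_pos hdpos hνa) hN key
  exact absurd (hN0 y) (not_le.2 hNy)

theorem painleveII_deriv_le_half (hν : ∀ y, HasDerivAt ν (N y) y)
    (hN : ∀ y, HasDerivAt N ((ν y ^ 3 - y * ν y) / 4) y)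
    (hpos : ∀ y, 0 < ν y) (hmono : Monotone ν) (hN0 : ∀ y, 0 ≤ N y) (hy₀ : 0 < y₀)
    (hfix : ν y₀ ^ 2 = y₀) (habove : ∀ y < y₀, y < ν y ^ 2) :
    N y₀ ≤ ν y₀ / 2 := by
  have hlog := painleveII_logConcave hν hN hpos hmono hN0 hfix habove
  by_contra! hlt
  have hν₀ := hpos y₀
  have hm : 0 < N y₀ := by linarith
  have hquot : ∀ y, HasDerivAt (fun y => -(N y / ν y))
      ((N y ^ 2 - ν y ^ 2 * (ν y ^ 2 - y) / 4) / ν y ^ 2) y := fun y => by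
    refine ((hN y).div (hν y) (hpos y).ne').neg.congr_deriv ?_
    have := (hpos y).ne'
    field_simp
    ring
  have hquotmono := monotoneOn_Iic_of_hasDerivAt_nonneg (a := y₀) hquot fun y hy =>
    div_nonneg (by linarith [hlog y hy.le]) (sq_nonneg _)
  have hgrowth : ∀ y ≤ y₀, N y₀ * ν y ≤ N y * ν y₀ := fun y hy => by
    have h := hquotmono (Set.mem_Iic.2 hy) Set.self_mem_Iic hy
    simp only [neg_le_neg_iff] at h
    exact (div_le_div_iff₀ hν₀ (hpos y)).1 h
  set k := ν y₀ / (4 * N y₀) with hk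
  have hkm : 4 * k * N y₀ = ν y₀ := by rw [hk]; field_simp
  have hkpos : 0 < k := by positivity
  have hF : ∀ y, HasDerivAt
      (fun y => k * ν y ^ 2 - (2 * N y ^ 2 + y * ν y ^ 2 / 2 - ν y ^ 4 / 4))
      (2 * k * ν y * N y - ν y ^ 2 / 2) y := fun y => by
    refine ((((hν y).pow 2).const_mul k).sub (((((hN y).pow 2).const_mul 2).add
      (((hasDerivAt_id y).mul ((hν y).pow 2)).div_const 2)).sub
        (((hν y).pow 4).div_const 4))).congr_deriv ?_
    simp
    ring
  have hFmono := monotoneOn_Iic_of_hasDerivAt_nonneg (a := y₀) hF fun y hy => by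
    have h := hgrowth y hy.le
    have h' : ν y ≤ 4 * k * N y := by
      rw [← hkm] at h
      exact le_of_mul_le_mul_left (by linarith) hm
    nlinarith [hpos y]
  have hend : k * ν y₀ ^ 2 - (2 * N y₀ ^ 2 + y₀ * ν y₀ ^ 2 / 2 - ν y₀ ^ 4 / 4) < 0 := by
    have h1 : k < 1 / 2 := by
      rw [hk, div_lt_iff₀ (by positivity)]
      linarith
    have h2 : ν y₀ ^ 2 < 4 * N y₀ ^ 2 := by nlinarith
    have h3 : y₀ * ν y₀ ^ 2 = ν y₀ ^ 4 := by
      linear_combination -ν y₀ ^ 2 * hfix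
    have h4 : 0 < ν y₀ ^ 4 := by positivity
    nlinarith [sq_nonneg (ν y₀)]
  set c := -(k * ν y₀ ^ 2 - (2 * N y₀ ^ 2 + y₀ * ν y₀ ^ 2 / 2 - ν y₀ ^ 4 / 4)) with hc
  have hcpos : 0 < c := by linarith
  have hlower : ∀ y ≤ 0, √(c / 2) ≤ N y := fun y hy => by
    have h := hFmono (Set.mem_Iic.2 (hy.trans hy₀.le)) Set.self_mem_Iic (hy.trans hy₀.le)
    simp only at h
    refine Real.sqrt_le_iff.2 ⟨hN0 y, ?_⟩
    have h1 : y * ν y ^ 2 ≤ 0 := mul_nonpos_of_nonpos_of_nonneg hy (sq_nonneg _)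
    have h2 : 0 ≤ k * ν y ^ 2 := by positivity
    have h3 : 0 ≤ ν y ^ 4 := by positivity
    linarith
  obtain ⟨y, -, hy⟩ := exists_le_neg_of_hasDerivAt_ge
    (Real.sqrt_pos.2 (half_pos hcpos)) hν hlower
  exact absurd (hpos y) hy.not_gt

end PainleveII

/-- second step in the proof of Lemma `V0below`. A bound on the slope of a
positive increasing Painlevé-II solution at its inflection point `y₀` (characterized by
`ν(y₀)² = y₀` and `ν(y)² > y` for `y < y₀`): `ν'(y₀) ≤ (9/32)^{1/3} √y₀`. -/
theorem slope_bound_at_inflection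
    (ν : ℝ → ℝ) (hC2 : ContDiff ℝ 2 ν)
    (hpos : ∀ y : ℝ, 0 < ν y)
    (hmono : StrictMono ν)
    (hode : ∀ y : ℝ, 4 * deriv (deriv ν) y + y * ν y - (ν y) ^ 3 = 0)
    (y₀ : ℝ) (hy₀ : 0 < y₀)
    (hfix : (ν y₀) ^ 2 = y₀)
    (habove : ∀ y : ℝ, y < y₀ → y < (ν y) ^ 2) :
    deriv ν y₀ ≤ ((9:ℝ)/32) ^ ((1:ℝ)/3) * Real.sqrt y₀ := by
  have hν : ∀ y, HasDerivAt ν (deriv ν y) y := fun y =>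
    (hC2.differentiable (by norm_num) y).hasDerivAt
  have hC1 : ContDiff ℝ 1 (deriv ν) :=
    ((contDiff_succ_iff_deriv (n := 1)).1 (by simpa [one_add_one_eq_two] using hC2)).2.2
  have hN : ∀ y, HasDerivAt (deriv ν) ((ν y ^ 3 - y * ν y) / 4) y := fun y =>
    (hC1.differentiable (by norm_num) y).hasDerivAt.congr_deriv (by linarith [hode y])
  have hhalf := painleveII_deriv_le_half hν hN hpos hmono.monotone
    (fun _ => hmono.monotone.deriv_nonneg) hy₀ hfix habove
  have hsqrt : √y₀ = ν y₀ := by rw [← Real.sqrt_sq (hpos y₀).le, hfix]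
  have hconst : (1 / 2 : ℝ) ≤ (9 / 32) ^ (1 / 3 : ℝ) := by
    rw [one_div 3, Real.le_rpow_inv_iff_of_pos (by norm_num) (by norm_num) (by norm_num)]
    norm_num
  rw [hsqrt]
  nlinarith [hpos y₀]
end
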